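/- Every triangulation of the Klein bottle N_2 contains a noncontractible separating cycle (NSC). -/

import Mathlib

open scoped Classical

/-- A combinatorial triangulation of a closed surface: a finite set of triangular
faces (3-element subsets of `ℕ`) such that every edge lies in exactly two faces,
the faces around each vertex form a single cycle (the link condition), and the
whole complex is connected.  The underlying simple graph has as edges the
2-element subsets of faces. -/
structure Triangulation where
  faces : Finset (Finset ℕ)
  faces_nonempty : faces.Nonempty
  card_eq_three : ∀ f ∈ faces, f.card = 3
  edge_in_two_faces : ∀ e : Finset ℕ, e.card = 2 → (∃ f ∈ faces, e ⊆ f) →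
    (faces.filter (fun f => e ⊆ f)).card = 2
  link_connected : ∀ v : ℕ, ∀ f ∈ faces, ∀ g ∈ faces, v ∈ f → v ∈ g →
    Relation.ReflTransGen
      (fun f' g' => f' ∈ faces ∧ g' ∈ faces ∧ v ∈ f' ∧ v ∈ g' ∧ (f' ∩ g').card = 2) f g
  face_connected : ∀ f ∈ faces, ∀ g ∈ faces,
    Relation.ReflTransGen
      (fun f' g' => f' ∈ faces ∧ g' ∈ faces ∧ (f' ∩ g').card = 2) f g

namespace Triangulation

/-- The vertices spanned by a set of faces. -/
def vertsOf (F : Finset (Finset ℕ)) : Finset ℕ := F.sup id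

/-- The edges spanned by a set of triangular faces: all 2-element subsets of faces. -/
def edgesOf (F : Finset (Finset ℕ)) : Finset (Finset ℕ) :=
  (Finset.powersetCard 2 (vertsOf F)).filter (fun e => ∃ f ∈ F, e ⊆ f)

/-- The vertex set of a triangulation. -/
def verts (T : Triangulation) : Finset ℕ := vertsOf T.faces

/-- The edge set of a triangulation. -/
def edges (T : Triangulation) : Finset (Finset ℕ) := edgesOf T.faces

/-- The Euler characteristic `V - E + F` of a triangulation. -/
def euler (T : Triangulation) : ℤ :=
  (T.verts.card : ℤ) - (T.edges.card : ℤ) + (T.faces.card : ℤ)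

/-- The three directed edges of an ordered triple (an oriented triangle). -/
def dedges (t : ℕ × ℕ × ℕ) : Finset (ℕ × ℕ) :=
  {(t.1, t.2.1), (t.2.1, t.2.2), (t.2.2, t.1)}

/-- `σ` is a coherent orientation of the set `F` of triangular faces: it assigns to each
face an oriented triangle with that vertex set, so that no directed edge is used twice
(equivalently, the two faces sharing an edge traverse that edge in opposite directions). -/
def IsCoherent (F : Finset (Finset ℕ)) (σ : Finset ℕ → ℕ × ℕ × ℕ) : Prop :=
  (∀ f ∈ F, ({(σ f).1, (σ f).2.1, (σ f).2.2} : Finset ℕ) = f) ∧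
  (∀ f ∈ F, ∀ g ∈ F, f ≠ g → Disjoint (dedges (σ f)) (dedges (σ g)))

/-- A triangulation is orientable if its faces admit a coherent orientation. -/
def Orientable (T : Triangulation) : Prop := ∃ σ, IsCoherent T.faces σ

/-- `T` is a triangulation of the orientable surface `S_g` of genus `g`
(Euler characteristic `2 - 2g`). -/
def IsS (g : ℕ) (T : Triangulation) : Prop :=
  T.euler = 2 - 2 * (g : ℤ) ∧ T.Orientable

/-- `T` is a triangulation of the nonorientable surface `N_g` of genus `g`
(Euler characteristic `2 - g`). -/
def IsN (g : ℕ) (T : Triangulation) : Prop :=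
  T.euler = 2 - (g : ℤ) ∧ ¬ T.Orientable

/-- The edges of the cyclic vertex sequence `c`. -/
def cycEdges (c : List ℕ) : Finset (Finset ℕ) :=
  (Finset.range c.length).image
    (fun i => ({c.getD i 0, c.getD ((i + 1) % c.length) 0} : Finset ℕ))

/-- `c` is a cycle of the triangulation `T`: at least three distinct vertices,
consecutive ones (cyclically) joined by edges of `T`. -/
def IsCycle (T : Triangulation) (c : List ℕ) : Prop :=
  3 ≤ c.length ∧ c.Nodup ∧ ∀ e ∈ cycEdges c, e ∈ T.edges

/-- Faces `f` and `g` lie in the same component of `S - C`, where `C` is the closed curve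
corresponding to the cycle `c`: they are joined by a chain of faces consecutively sharing
edges that are not edges of the cycle. -/
def SameSide (T : Triangulation) (c : List ℕ) (f g : Finset ℕ) : Prop :=
  Relation.ReflTransGen
    (fun f' g' => f' ∈ T.faces ∧ g' ∈ T.faces ∧ (f' ∩ g').card = 2 ∧
      f' ∩ g' ∉ cycEdges c) f g

/-- The cycle `c` separates the surface: `S - C` is disconnected. -/
def Separating (T : Triangulation) (c : List ℕ) : Prop :=
  ∃ f ∈ T.faces, ∃ g ∈ T.faces, ¬ SameSide T c f g

/-- The faces in the component of `S - C` containing the face `f`. -/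
noncomputable def sideFaces (T : Triangulation) (c : List ℕ) (f : Finset ℕ) :
    Finset (Finset ℕ) :=
  T.faces.filter (fun g => SameSide T c f g)

/-- The Euler characteristic of the component of `f` in the surface cut along the cycle
`c`, capped with a single new face (`+1`). -/
noncomputable def sideEuler (T : Triangulation) (c : List ℕ) (f : Finset ℕ) : ℤ :=
  ((vertsOf (sideFaces T c f)).card : ℤ) - ((edgesOf (sideFaces T c f)).card : ℤ)
    + ((sideFaces T c f).card : ℤ) + 1

/-- The Euler genus `2 - χ` of the capped component of `f` in the surface cut
along the cycle `c`. -/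
noncomputable def sideEulerGenus (T : Triangulation) (c : List ℕ) (f : Finset ℕ) : ℤ :=
  2 - sideEuler T c f

/-- The capped component of `f` in the surface cut along the cycle `c` is orientable. -/
def SideOrientable (T : Triangulation) (c : List ℕ) (f : Finset ℕ) : Prop :=
  ∃ σ, IsCoherent (sideFaces T c f) σ

/-- `c` is a noncontractible separating cycle (NSC): it separates the surface and
neither capped component is a triangulation of the sphere (`χ = 2`). -/
def IsNSC (T : Triangulation) (c : List ℕ) : Prop :=
  IsCycle T c ∧ Separating T c ∧ ∀ f ∈ T.faces, sideEuler T c f ≠ 2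

/-- A coherent orientation of the faces of `T` in which the gluing across the edges of the
cycle `c` is ignored: this orients the surface obtained by cutting along `c`. -/
def IsCutCoherent (T : Triangulation) (c : List ℕ) (σ : Finset ℕ → ℕ × ℕ × ℕ) : Prop :=
  (∀ f ∈ T.faces, ({(σ f).1, (σ f).2.1, (σ f).2.2} : Finset ℕ) = f) ∧
  (∀ f ∈ T.faces, ∀ g ∈ T.faces, f ≠ g → f ∩ g ∉ cycEdges c →
    Disjoint (dedges (σ f)) (dedges (σ g)))

/-- The cycle `c` is orientable-leaving: the surface obtained by cutting along `c`
is orientable. -/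
def OrientableLeaving (T : Triangulation) (c : List ℕ) : Prop :=
  ∃ σ, IsCutCoherent T c σ

/-- A corner of the cycle `c`: a pair `(i, f)` where `f` is a face containing the `i`-th
vertex of `c`. -/
def IsCorner (T : Triangulation) (c : List ℕ) (x : ℕ × Finset ℕ) : Prop :=
  x.1 < c.length ∧ x.2 ∈ T.faces ∧ c.getD x.1 0 ∈ x.2

/-- Two corners lie on a common boundary segment of the surface cut along `c`:
either they are corners at the same cycle vertex whose faces share an edge through that
vertex not lying on the cycle, or they are corners of one face containing a cycle edge,
at the two endpoints of that edge. -/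
def CornerRel (T : Triangulation) (c : List ℕ) (x y : ℕ × Finset ℕ) : Prop :=
  IsCorner T c x ∧ IsCorner T c y ∧
  ((x.1 = y.1 ∧ (x.2 ∩ y.2).card = 2 ∧ c.getD x.1 0 ∈ x.2 ∩ y.2 ∧
      x.2 ∩ y.2 ∉ cycEdges c) ∨
    (y.1 = (x.1 + 1) % c.length ∧ x.2 = y.2 ∧
      ({c.getD x.1 0, c.getD y.1 0} : Finset ℕ) ⊆ x.2))

/-- The cycle `c` is one-sided: cutting the surface along `c` produces a single boundary
cycle, i.e. all corners along `c` lie on one boundary component (the neighborhood of the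
curve is a Möbius band).  A nonseparating cycle is two-sided iff it is not one-sided. -/
def OneSided (T : Triangulation) (c : List ℕ) : Prop :=
  ∀ x y, IsCorner T c x → IsCorner T c y → Relation.EqvGen (CornerRel T c) x y

/-- The 3-cycles (triangles) of the graph of `T`. -/
def triangles (T : Triangulation) : Finset (Finset ℕ) :=
  (Finset.powersetCard 3 T.verts).filter
    (fun t => ∀ e ∈ Finset.powersetCard 2 t, e ∈ T.edges)

/-- An edge of `T` is contractible iff it lies in exactly two 3-cycles of the graph of
`T` (for any triangulation other than `K₄` on the sphere, this is equivalent to the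
contraction of the edge yielding again a triangulation of the same surface). -/
def ContractibleEdge (T : Triangulation) (e : Finset ℕ) : Prop :=
  e ∈ T.edges ∧ (T.triangles.filter (fun t => e ⊆ t)).card = 2

/-- A triangulation is irreducible if it has no contractible edge. -/
def Irreducible (T : Triangulation) : Prop :=
  ∀ e, ¬ ContractibleEdge T e

/-- Two face sets are equivalent if some relabelling of the vertices carries one onto the
other (such a bijection carries faces to faces and hence edges to edges). -/
def FacesEquiv (F F' : Finset (Finset ℕ)) : Prop :=
  ∃ φ : ℕ ≃ ℕ, F' = F.image (fun f => f.image φ)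

/-- Two triangulations are equivalent if some vertex bijection carries faces to faces
(and hence edges to edges). -/
def EquivTri (T T' : Triangulation) : Prop := FacesEquiv T.faces T'.faces

/-- `T'` is obtained from `T` by a diagonal flip: the edge `{a,c}`, lying in the faces
`{a,b,c}` and `{a,c,d}` with `{b,d}` not an edge, is replaced by `{b,d}` and the two
faces by `{a,b,d}` and `{b,c,d}`. -/
def Flip (T T' : Triangulation) : Prop :=
  ∃ a b c d : ℕ, ({a, b, c} : Finset ℕ) ∈ T.faces ∧ ({a, c, d} : Finset ℕ) ∈ T.faces ∧
    b ≠ d ∧ ({b, d} : Finset ℕ) ∉ T.edges ∧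
    T'.faces = (T.faces \ {({a, b, c} : Finset ℕ), ({a, c, d} : Finset ℕ)}) ∪
      {({a, b, d} : Finset ℕ), ({b, c, d} : Finset ℕ)}

/-- Two triangulations are equivalent under diagonal flips if a finite sequence of
diagonal flips transforms one into a triangulation equivalent to the other. -/
def FlipEquiv (T T' : Triangulation) : Prop :=
  ∃ T'' : Triangulation, Relation.ReflTransGen Flip T T'' ∧ EquivTri T'' T'

end Triangulation

namespace Triangulation

theorem mem_edges {T : Triangulation} {e : Finset ℕ} :
    e ∈ T.edges ↔ e.card = 2 ∧ ∃ f ∈ T.faces, e ⊆ f := by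
  unfold edges edgesOf vertsOf
  rw [Finset.mem_filter, Finset.mem_powersetCard]
  constructor
  · rintro ⟨⟨-, h⟩, h'⟩
    exact ⟨h, h'⟩
  · rintro ⟨h, f, hf, hef⟩
    exact ⟨⟨hef.trans (Finset.le_sup (f := id) hf), h⟩, f, hf, hef⟩

theorem mem_verts {T : Triangulation} {v : ℕ} : v ∈ T.verts ↔ ∃ f ∈ T.faces, v ∈ f := by
  simp [verts, vertsOf, Finset.mem_sup]

theorem pair_mem_edges {T : Triangulation} {f : Finset ℕ} (hf : f ∈ T.faces) {u v : ℕ}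
    (hu : u ∈ f) (hv : v ∈ f) (huv : u ≠ v) : ({u, v} : Finset ℕ) ∈ T.edges :=
  mem_edges.2 ⟨Finset.card_pair huv, f, hf, by
    intro x hx; simp only [Finset.mem_insert, Finset.mem_singleton] at hx
    rcases hx with rfl | rfl <;> assumption⟩

theorem ne_of_pair_mem_edges {T : Triangulation} {u v : ℕ}
    (h : ({u, v} : Finset ℕ) ∈ T.edges) : u ≠ v := by
  rintro rfl
  simpa using (mem_edges.1 h).1

theorem exists_faces_of_edge {T : Triangulation} {e : Finset ℕ} (he : e ∈ T.edges) :
    ∃ f g, f ∈ T.faces ∧ g ∈ T.faces ∧ f ≠ g ∧ e ⊆ f ∧ e ⊆ g := by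
  obtain ⟨h2, h⟩ := mem_edges.1 he
  obtain ⟨f, g, hfg, h⟩ := Finset.card_eq_two.1 (T.edge_in_two_faces e h2 h)
  have hf : f ∈ T.faces.filter (fun f => e ⊆ f) := by rw [h]; simp
  have hg : g ∈ T.faces.filter (fun f => e ⊆ f) := by rw [h]; simp
  rw [Finset.mem_filter] at hf hg
  exact ⟨f, g, hf.1, hg.1, hfg, hf.2, hg.2⟩

theorem faces_of_edge {T : Triangulation} {e f g : Finset ℕ} (he : e.card = 2)
    (hf : f ∈ T.faces) (hg : g ∈ T.faces) (hfg : f ≠ g) (hef : e ⊆ f) (heg : e ⊆ g) :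
    T.faces.filter (fun f => e ⊆ f) = {f, g} := by
  symm
  apply Finset.eq_of_subset_of_card_le
  · intro x hx
    simp only [Finset.mem_insert, Finset.mem_singleton] at hx
    rcases hx with rfl | rfl <;> simp [*]
  · rw [T.edge_in_two_faces e he ⟨f, hf, hef⟩, Finset.card_pair hfg]

theorem sum_faces_of_edge {T : Triangulation} {M : Type*} [AddCommMonoid M] {e f g : Finset ℕ}
    (he : e.card = 2) (hf : f ∈ T.faces) (hg : g ∈ T.faces) (hfg : f ≠ g) (hef : e ⊆ f)
    (heg : e ⊆ g) (φ : Finset ℕ → M) :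
    ∑ h ∈ T.faces with e ⊆ h, φ h = φ f + φ g := by
  rw [faces_of_edge he hf hg hfg hef heg, Finset.sum_pair hfg]

theorem inter_eq_of_subset {T : Triangulation} {e f g : Finset ℕ} (he : e.card = 2)
    (hf : f ∈ T.faces) (hg : g ∈ T.faces) (hfg : f ≠ g) (hef : e ⊆ f) (heg : e ⊆ g) :
    f ∩ g = e := by
  symm
  apply Finset.eq_of_subset_of_card_le (Finset.subset_inter hef heg)
  rw [he]
  by_contra! h
  have h3 := T.card_eq_three f hf
  have h3' := T.card_eq_three g hg
  have h1 : f ∩ g = f := Finset.eq_of_subset_of_card_le Finset.inter_subset_left (by omega)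
  have h2 : f ∩ g = g := Finset.eq_of_subset_of_card_le Finset.inter_subset_right (by omega)
  exact hfg (h1.symm.trans h2)

theorem inter_mem_edges {T : Triangulation} {f g : Finset ℕ} (hf : f ∈ T.faces)
    (h : (f ∩ g).card = 2) : f ∩ g ∈ T.edges :=
  mem_edges.2 ⟨h, f, hf, Finset.inter_subset_left⟩

theorem ne_of_card_inter {T : Triangulation} {f g : Finset ℕ} (hf : f ∈ T.faces)
    (h : (f ∩ g).card = 2) : f ≠ g := by
  rintro rfl
  rw [Finset.inter_self, T.card_eq_three f hf] at h
  omega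

theorem exists_lt_lt {T : Triangulation} {f : Finset ℕ} (hf : f ∈ T.faces) :
    ∃ a b c, a < b ∧ b < c ∧ f = {a, b, c} := by
  obtain ⟨a, b, c, h1, h2, h3, rfl⟩ := Finset.card_eq_three.1 (T.card_eq_three f hf)
  rcases lt_or_gt_of_ne h1 with h1 | h1 <;> rcases lt_or_gt_of_ne h2 with h2 | h2 <;>
    rcases lt_or_gt_of_ne h3 with h3 | h3
  · exact ⟨a, b, c, h1, h3, rfl⟩
  · exact ⟨a, c, b, h2, h3, by ext; simp; tauto⟩
  · omega
  · exact ⟨c, a, b, h2, h1, by ext; simp; tauto⟩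
  · exact ⟨b, a, c, h1, h2, by ext; simp; tauto⟩
  · omega
  · exact ⟨b, c, a, h3, h2, by ext; simp; tauto⟩
  · exact ⟨c, b, a, h3, h1, by ext; simp; tauto⟩

theorem exists_third {T : Triangulation} {f : Finset ℕ} (hf : f ∈ T.faces) {u v : ℕ}
    (hu : u ∈ f) (hv : v ∈ f) (huv : u ≠ v) : ∃ x, x ≠ u ∧ x ≠ v ∧ f = {u, v, x} := by
  have h : (f \ {u, v}).card = 1 := by
    rw [Finset.card_sdiff_of_subset, T.card_eq_three f hf, Finset.card_pair huv]
    intro x hx; simp only [Finset.mem_insert, Finset.mem_singleton] at hx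
    rcases hx with rfl | rfl <;> assumption
  obtain ⟨x, hx⟩ := Finset.card_eq_one.1 h
  have hx' : x ∈ f \ {u, v} := by rw [hx]; simp
  simp only [Finset.mem_sdiff, Finset.mem_insert, Finset.mem_singleton, not_or] at hx'
  refine ⟨x, hx'.2.1, hx'.2.2, ?_⟩
  ext y
  have := Finset.ext_iff.1 hx y
  simp only [Finset.mem_sdiff, Finset.mem_insert, Finset.mem_singleton, not_or] at this ⊢
  constructor
  · intro hy; by_cases h1 : y = u <;> by_cases h2 : y = v <;> simp_all
  · rintro (rfl | rfl | rfl) <;> [exact hu; exact hv; exact hx'.1]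

theorem edges_of_face {T : Triangulation} {a b c : ℕ} (hab : a ≠ b) (hac : a ≠ c) (hbc : b ≠ c)
    (hf : ({a, b, c} : Finset ℕ) ∈ T.faces) :
    T.edges.filter (fun e => e ⊆ {a, b, c}) = {{a, b}, {a, c}, {b, c}} := by
  ext e
  rw [Finset.mem_filter, mem_edges]
  simp only [Finset.mem_insert, Finset.mem_singleton]
  constructor
  · rintro ⟨⟨h2, -⟩, h⟩
    obtain ⟨x, y, hxy, rfl⟩ := Finset.card_eq_two.1 h2
    have hx := h (Finset.mem_insert_self x {y})
    have hy := h (Finset.mem_insert_of_mem (Finset.mem_singleton_self y) : y ∈ ({x, y} : Finset ℕ))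
    simp only [Finset.mem_insert, Finset.mem_singleton] at hx hy
    rcases hx with rfl | rfl | rfl <;> rcases hy with rfl | rfl | rfl <;>
      simp_all [Finset.pair_comm]
  · rintro (rfl | rfl | rfl)
    · exact ⟨⟨Finset.card_pair hab, _, hf, by intro x; simp; tauto⟩, by intro x; simp; tauto⟩
    · exact ⟨⟨Finset.card_pair hac, _, hf, by intro x; simp; tauto⟩, by intro x; simp; tauto⟩
    · exact ⟨⟨Finset.card_pair hbc, _, hf, by intro x; simp; tauto⟩, by intro x; simp; tauto⟩

theorem pair_ne_pair {a b c : ℕ} (h : b ≠ c) : ({a, b} : Finset ℕ) ≠ {a, c} := by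
  intro h'
  have h1 := Finset.ext_iff.1 h' b
  have h2 := Finset.ext_iff.1 h' c
  simp at h1 h2
  omega

theorem sum_edges_of_face {T : Triangulation} {M : Type*} [AddCommMonoid M] {a b c : ℕ}
    (hab : a ≠ b) (hac : a ≠ c) (hbc : b ≠ c) (hf : ({a, b, c} : Finset ℕ) ∈ T.faces)
    (φ : Finset ℕ → M) :
    ∑ e ∈ T.edges with e ⊆ {a, b, c}, φ e = φ {a, b} + (φ {a, c} + φ {b, c}) := by
  rw [edges_of_face hab hac hbc hf, Finset.sum_insert, Finset.sum_pair]
  · rw [Finset.pair_comm a c, Finset.pair_comm b c]; exact pair_ne_pair hab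
  · simp only [Finset.mem_insert, Finset.mem_singleton, not_or]
    refine ⟨pair_ne_pair hbc, ?_⟩
    rw [Finset.pair_comm a b]; exact pair_ne_pair hac

theorem sum_edges_sum_faces {T : Triangulation} {M : Type*} [AddCommMonoid M]
    (φ : Finset ℕ → Finset ℕ → M) :
    ∑ e ∈ T.edges, ∑ f ∈ T.faces with e ⊆ f, φ e f =
      ∑ f ∈ T.faces, ∑ e ∈ T.edges with e ⊆ f, φ e f := by
  apply Finset.sum_comm'
  intro x y; simp only [Finset.mem_filter]; tauto

theorem eq_on_star {T : Triangulation} {α : Type*} {v : ℕ} {φ : Finset ℕ → α}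
    (h : ∀ u, u ≠ v → ∀ f ∈ T.faces, ∀ g ∈ T.faces, f ≠ g → {v, u} ⊆ f → {v, u} ⊆ g → φ f = φ g)
    {f g : Finset ℕ} (hf : f ∈ T.faces) (hg : g ∈ T.faces) (hvf : v ∈ f) (hvg : v ∈ g) :
    φ f = φ g := by
  have := T.link_connected v f hf g hg hvf hvg
  clear hg hvg
  induction this with
  | refl => rfl
  | tail _ h' ih =>
    rename_i b c _
    obtain ⟨hb, hc, hvb, hvc, h2⟩ := h'
    rw [ih]
    have hv : v ∈ b ∩ c := Finset.mem_inter.2 ⟨hvb, hvc⟩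
    have : ((b ∩ c).erase v).card = 1 := by rw [Finset.card_erase_of_mem hv, h2]
    obtain ⟨u, hu⟩ := Finset.card_eq_one.1 this
    have hu' : u ∈ (b ∩ c).erase v := by rw [hu]; simp
    simp only [Finset.mem_erase, Finset.mem_inter] at hu'
    refine h u hu'.1 b hb c hc (ne_of_card_inter hb h2) ?_ ?_ <;>
    · intro x hx
      simp only [Finset.mem_insert, Finset.mem_singleton] at hx
      rcases hx with rfl | rfl <;> tauto

theorem eq_on_faces {T : Triangulation} {α : Type*} {φ : Finset ℕ → α}
    (h : ∀ f ∈ T.faces, ∀ g ∈ T.faces, f ≠ g → f ∩ g ∈ T.edges → φ f = φ g)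
    {f g : Finset ℕ} (hf : f ∈ T.faces) (hg : g ∈ T.faces) : φ f = φ g := by
  have := T.face_connected f hf g hg
  clear hg
  induction this with
  | refl => rfl
  | tail _ h' ih =>
    obtain ⟨hb, hc, h2⟩ := h'
    rw [ih]
    exact h _ hb _ hc (ne_of_card_inter hb h2) (inter_mem_edges hb h2)

/-- A vertex function agreeing at the ends of every edge is constant. -/
theorem eq_on_verts {T : Triangulation} {α : Type*} {φ : ℕ → α}
    (h : ∀ u v, ({u, v} : Finset ℕ) ∈ T.edges → φ u = φ v)
    {u v : ℕ} (hu : u ∈ T.verts) (hv : v ∈ T.verts) : φ u = φ v := by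
  obtain ⟨f, hf, huf⟩ := mem_verts.1 hu
  obtain ⟨g, hg, hvg⟩ := mem_verts.1 hv
  have key : ∀ f ∈ T.faces, ∀ x ∈ f, ∀ y ∈ f, φ x = φ y := by
    intro f hf x hx y hy
    by_cases hxy : x = y
    · rw [hxy]
    · exact h x y (pair_mem_edges hf hx hy hxy)
  have hne : ∀ f ∈ T.faces, f.Nonempty := fun f hf => by
    rw [← Finset.card_pos, T.card_eq_three f hf]; norm_num
  have := eq_on_faces (T := T) (φ := fun f => if h : f.Nonempty then φ h.choose else φ u) (by
    intro f hf g hg _ he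
    simp only [hne f hf, hne g hg, dif_pos]
    have h2 := (mem_edges.1 he).1
    obtain ⟨x, hx⟩ := Finset.card_pos.1 (by omega : 0 < (f ∩ g).card)
    rw [Finset.mem_inter] at hx
    rw [key f hf _ (hne f hf).choose_spec x hx.1, key g hg _ (hne g hg).choose_spec x hx.2]) hf hg
  simp only [hne f hf, hne g hg, dif_pos] at this
  rw [key f hf u huf _ (hne f hf).choose_spec, this, key g hg _ (hne g hg).choose_spec v hvg]

/-- A vector over `ZMod 2` annihilated by everything annihilating the rows of a matrix is a
combination of the rows. -/
theorem exists_sum_of_annihilator {α β : Type*} (I : Finset α) (J : Finset β)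
    (M : α → β → ZMod 2) (y : β → ZMod 2)
    (h : ∀ g : β → ZMod 2, (∀ i ∈ I, ∑ j ∈ J, g j * M i j = 0) → ∑ j ∈ J, g j * y j = 0) :
    ∃ x : α → ZMod 2, ∀ j ∈ J, y j = ∑ i ∈ I, x i * M i j := by
  let row : I → (J → ZMod 2) := fun i j => M i j
  have hy : (fun j : J => y j) ∈ Submodule.span (ZMod 2) (Set.range row) := by
    by_contra hy
    obtain ⟨φ, hφ, hle⟩ := Submodule.exists_le_ker_of_notMem hy
    have hrep : ∀ z : J → ZMod 2, φ z = ∑ j : J, φ (Pi.single j 1) * z j := by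
      intro z
      rw [LinearMap.pi_apply_eq_sum_univ φ z]
      refine Finset.sum_congr rfl fun j _ => ?_
      rw [smul_eq_mul, mul_comm]
      congr 2
      ext k; simp [Pi.single_apply, eq_comm]
    apply hφ
    rw [hrep]
    have := h (fun j => if hj : j ∈ J then φ (Pi.single ⟨j, hj⟩ 1) else 0) (by
      intro i hi
      have h0 : φ (row ⟨i, hi⟩) = 0 := hle (Submodule.subset_span ⟨_, rfl⟩)
      rw [hrep] at h0
      rw [← h0, ← Finset.sum_coe_sort J]
      exact Finset.sum_congr rfl fun j _ => by simp [row])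
    rw [← Finset.sum_coe_sort J] at this
    rw [← this]
    exact Finset.sum_congr rfl fun j _ => by simp
  obtain ⟨c, hc⟩ := (Submodule.mem_span_range_iff_exists_fun _).1 hy
  refine ⟨fun i => if hi : i ∈ I then c ⟨i, hi⟩ else 0, fun j hj => ?_⟩
  have := congrFun hc ⟨j, hj⟩
  rw [Finset.sum_apply] at this
  rw [← this, ← Finset.sum_coe_sort I]
  exact Finset.sum_congr rfl fun i _ => by simp [row]

variable {T : Triangulation}

/-- Pairing of two `ZMod 2`-valued functions on the edges. -/
noncomputable def pr (T : Triangulation) (ζ Z : Finset ℕ → ZMod 2) : ZMod 2 :=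
  ∑ e ∈ T.edges, ζ e * Z e

/-- `Z` is a `ZMod 2`-cycle. -/
def IsCyc (T : Triangulation) (Z : Finset ℕ → ZMod 2) : Prop :=
  ∀ v, ∑ e ∈ T.edges with v ∈ e, Z e = 0

/-- `ζ` is a `ZMod 2`-cocycle. -/
def IsCocyc (T : Triangulation) (ζ : Finset ℕ → ZMod 2) : Prop :=
  ∀ f ∈ T.faces, ∑ e ∈ T.edges with e ⊆ f, ζ e = 0

/-- The coboundary of a vertex function. -/
def cob (U : ℕ → ZMod 2) (e : Finset ℕ) : ZMod 2 := ∑ v ∈ e, U v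

/-- The boundary of a face function. -/
noncomputable def bd (T : Triangulation) (x : Finset ℕ → ZMod 2) (e : Finset ℕ) : ZMod 2 :=
  ∑ f ∈ T.faces with e ⊆ f, x f

/-- A corner function `lam` exhibiting the Poincaré duality between the cycle `Z` and the
cocycle `ζ`. -/
structure Dual (T : Triangulation) (lam : ℕ → Finset ℕ → ZMod 2) (Z ζ : Finset ℕ → ZMod 2) :
    Prop where
  face : ∀ f ∈ T.faces, ∀ u ∈ f, ∀ v ∈ f, u ≠ v → ζ {u, v} = lam u f + lam v f
  vert : ∀ u v, u ≠ v → ∀ f ∈ T.faces, ∀ g ∈ T.faces, f ≠ g → {u, v} ⊆ f → {u, v} ⊆ g →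
    Z {u, v} = lam u f + lam u g

theorem cob_pair (U : ℕ → ZMod 2) {u v : ℕ} (h : u ≠ v) : cob U {u, v} = U u + U v :=
  Finset.sum_pair h

theorem exists_pair {e : Finset ℕ} (he : e ∈ T.edges) :
    ∃ u v f g, u < v ∧ e = {u, v} ∧ f ∈ T.faces ∧ g ∈ T.faces ∧ f ≠ g ∧
      ({u, v} : Finset ℕ) ⊆ f ∧ ({u, v} : Finset ℕ) ⊆ g := by
  obtain ⟨f, g, hf, hg, hfg, hef, heg⟩ := exists_faces_of_edge he
  obtain ⟨u, v, huv, rfl⟩ := Finset.card_eq_two.1 (mem_edges.1 he).1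
  rcases lt_or_gt_of_ne huv with h | h
  · exact ⟨u, v, f, g, h, rfl, hf, hg, hfg, hef, heg⟩
  · rw [Finset.pair_comm] at *
    exact ⟨v, u, f, g, h, rfl, hf, hg, hfg, hef, heg⟩

theorem pair_subset {u v : ℕ} {f : Finset ℕ} : ({u, v} : Finset ℕ) ⊆ f ↔ u ∈ f ∧ v ∈ f := by
  rw [Finset.insert_subset_iff, Finset.singleton_subset_iff]

theorem IsCocyc.face_eq {ζ : Finset ℕ → ZMod 2} (h : T.IsCocyc ζ) {a b c : ℕ} (hab : a ≠ b)
    (hac : a ≠ c) (hbc : b ≠ c) (hf : ({a, b, c} : Finset ℕ) ∈ T.faces) :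
    ζ {a, b} + (ζ {a, c} + ζ {b, c}) = 0 := by
  rw [← sum_edges_of_face hab hac hbc hf]
  exact h _ hf

theorem isCocyc_iff {ζ : Finset ℕ → ZMod 2} : T.IsCocyc ζ ↔ ∀ a b c, a ≠ b → a ≠ c → b ≠ c →
    ({a, b, c} : Finset ℕ) ∈ T.faces → ζ {a, b} + (ζ {a, c} + ζ {b, c}) = 0 := by
  refine ⟨fun h a b c h1 h2 h3 => h.face_eq h1 h2 h3, fun h f hf => ?_⟩
  obtain ⟨a, b, c, h1, h2, rfl⟩ := exists_lt_lt hf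
  rw [sum_edges_of_face h1.ne (h1.trans h2).ne h2.ne hf]
  exact h _ _ _ h1.ne (h1.trans h2).ne h2.ne hf

theorem isCocyc_cob (U : ℕ → ZMod 2) : T.IsCocyc (cob U) := by
  rw [isCocyc_iff]
  intro a b c hab hac hbc _
  rw [cob_pair U hab, cob_pair U hac, cob_pair U hbc]
  grind

theorem IsCocyc.add {ζ ζ' : Finset ℕ → ZMod 2} (h : T.IsCocyc ζ) (h' : T.IsCocyc ζ') :
    T.IsCocyc (ζ + ζ') := by
  intro f hf
  simp only [Pi.add_apply, Finset.sum_add_distrib, h f hf, h' f hf, add_zero]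

theorem IsCyc.add {Z Z' : Finset ℕ → ZMod 2} (h : T.IsCyc Z) (h' : T.IsCyc Z') :
    T.IsCyc (Z + Z') := by
  intro v
  simp only [Pi.add_apply, Finset.sum_add_distrib, h v, h' v, add_zero]

theorem pr_add_left (ζ ζ' Z : Finset ℕ → ZMod 2) :
    T.pr (ζ + ζ') Z = T.pr ζ Z + T.pr ζ' Z := by
  simp only [pr, Pi.add_apply, add_mul, Finset.sum_add_distrib]

theorem pr_add_right (ζ Z Z' : Finset ℕ → ZMod 2) :
    T.pr ζ (Z + Z') = T.pr ζ Z + T.pr ζ Z' := by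
  simp only [pr, Pi.add_apply, mul_add, Finset.sum_add_distrib]

theorem pr_congr_left {ζ ζ' : Finset ℕ → ZMod 2} (h : ∀ e ∈ T.edges, ζ e = ζ' e)
    (Z : Finset ℕ → ZMod 2) : T.pr ζ Z = T.pr ζ' Z :=
  Finset.sum_congr rfl fun e he => by rw [h e he]

theorem subset_verts {e : Finset ℕ} (he : e ∈ T.edges) : e ⊆ T.verts := fun v hv => by
  obtain ⟨f, hf, hef⟩ := (mem_edges.1 he).2
  exact mem_verts.2 ⟨f, hf, hef hv⟩

theorem cob_eq_sum {U : ℕ → ZMod 2} {e : Finset ℕ} (he : e ∈ T.edges) :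
    cob U e = ∑ v ∈ T.verts, U v * if v ∈ e then 1 else 0 := by
  simp only [mul_ite, mul_one, mul_zero]
  rw [← Finset.sum_filter, Finset.filter_mem_eq_inter, Finset.inter_eq_right.2 (subset_verts he)]
  rfl

theorem IsCyc.pr_cob {Z : Finset ℕ → ZMod 2} (h : T.IsCyc Z) (U : ℕ → ZMod 2) :
    T.pr (cob U) Z = 0 := by
  have : T.pr (cob U) Z = ∑ v ∈ T.verts, U v * ∑ e ∈ T.edges with v ∈ e, Z e := by
    simp only [Finset.mul_sum, Finset.sum_filter]
    rw [Finset.sum_comm, pr]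
    refine Finset.sum_congr rfl fun e he => ?_
    rw [cob_eq_sum he, Finset.sum_mul]
    exact Finset.sum_congr rfl fun v _ => by split_ifs <;> simp
  rw [this]
  exact Finset.sum_eq_zero fun v _ => by rw [h v, mul_zero]

theorem IsCocyc.pr_bd {ζ : Finset ℕ → ZMod 2} (h : T.IsCocyc ζ) (x : Finset ℕ → ZMod 2) :
    T.pr ζ (T.bd x) = 0 := by
  simp only [pr, bd, Finset.mul_sum]
  rw [sum_edges_sum_faces fun e f => ζ e * x f]
  refine Finset.sum_eq_zero fun f hf => ?_
  rw [← Finset.sum_mul, h f hf, zero_mul]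

/-- A cochain vanishing on all cycles is a coboundary. -/
theorem exists_cob {ζ : Finset ℕ → ZMod 2} (h : ∀ Z, T.IsCyc Z → T.pr ζ Z = 0) :
    ∃ U, ∀ e ∈ T.edges, ζ e = cob U e := by
  obtain ⟨x, hx⟩ := exists_sum_of_annihilator T.verts T.edges
    (fun v e => if v ∈ e then 1 else 0) ζ (by
      intro g hg
      rw [← h g]
      · exact Finset.sum_congr rfl fun e _ => mul_comm _ _
      · intro v
        rw [Finset.sum_filter]
        by_cases hv : v ∈ T.verts
        · simpa using hg v hv
        · exact Finset.sum_eq_zero fun e he => if_neg fun hve => hv (subset_verts he hve))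
  exact ⟨x, fun e he => by rw [hx e he, cob_eq_sum he]⟩

/-- A chain killed by all cocycles is a boundary. -/
theorem exists_bd {Z : Finset ℕ → ZMod 2} (h : ∀ ζ, T.IsCocyc ζ → T.pr ζ Z = 0) :
    ∃ x, ∀ e ∈ T.edges, Z e = T.bd x e := by
  obtain ⟨x, hx⟩ := exists_sum_of_annihilator T.faces T.edges
    (fun f e => if e ⊆ f then 1 else 0) Z (by
      intro g hg
      apply h g
      intro f hf
      rw [Finset.sum_filter]
      simpa using hg f hf)
  refine ⟨x, fun e he => ?_⟩
  rw [hx e he, bd, Finset.sum_filter]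
  simp

theorem bd_pair {x : Finset ℕ → ZMod 2} {e f g : Finset ℕ} (he : e.card = 2) (hf : f ∈ T.faces)
    (hg : g ∈ T.faces) (hfg : f ≠ g) (hef : e ⊆ f) (heg : e ⊆ g) : T.bd x e = x f + x g :=
  sum_faces_of_edge he hf hg hfg hef heg x

theorem zmod_add_self (a : ZMod 2) : a + a = 0 := by revert a; decide

theorem IsCyc.const_mul {Z : Finset ℕ → ZMod 2} (h : T.IsCyc Z) (v : ℕ) (c : ZMod 2) :
    ∑ e ∈ T.edges with v ∈ e, c * Z e = 0 := by
  rw [← Finset.mul_sum, h v, mul_zero]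

/-- Local potential of a cycle around a vertex. -/
theorem IsCyc.exists_local {Z : Finset ℕ → ZMod 2} (h : T.IsCyc Z) (v : ℕ) :
    ∃ x : Finset ℕ → ZMod 2, ∀ u, u ≠ v → ∀ f ∈ T.faces, ∀ g ∈ T.faces, f ≠ g → {v, u} ⊆ f →
      {v, u} ⊆ g → Z {v, u} = x f + x g := by
  obtain ⟨x, hx⟩ := exists_sum_of_annihilator (T.faces.filter fun f => v ∈ f)
    (T.edges.filter fun e => v ∈ e) (fun f e => if e ⊆ f then 1 else 0) Z (by
      intro g hg
      have h1 : ∀ f ∈ T.faces, ∀ a ∈ f, ∀ b ∈ f, v ∈ f → a ≠ v → b ≠ v → g {v, a} = g {v, b} := by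
        intro f hf a ha b hb hv hav hbv
        by_cases hab : a = b
        · rw [hab]
        obtain ⟨y, h1, h2, rfl⟩ := exists_third hf hv ha hav.symm
        obtain rfl : b = y := by
          simp only [Finset.mem_insert, Finset.mem_singleton] at hb; grind
        have := hg _ (Finset.mem_filter.2 ⟨hf, hv⟩)
        simp only [mul_ite, mul_one, mul_zero] at this
        rw [Finset.sum_filter] at this
        have h3 : ∀ e, (if v ∈ e then if e ⊆ ({v, a, b} : Finset ℕ) then g e else 0 else 0) =
            if e ⊆ ({v, a, b} : Finset ℕ) then if v ∈ e then g e else 0 else 0 := by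
          intro e; split_ifs <;> rfl
        simp only [h3] at this
        rw [← Finset.sum_filter, sum_edges_of_face hav.symm hbv.symm hab hf] at this
        simp only [Finset.mem_insert, Finset.mem_singleton, true_or, if_true, hav.symm, hbv.symm,
          or_self, if_false, add_zero] at this
        grind
      have h2 : ∀ f ∈ T.faces, v ∈ f → ∃ u ∈ f, u ≠ v := by
        intro f hf hv
        by_contra! h'
        have := Finset.card_le_card (fun x hx => Finset.mem_singleton.2 (h' x hx) : f ⊆ {v})
        rw [T.card_eq_three f hf, Finset.card_singleton] at this
        omega
      let φ : Finset ℕ → ZMod 2 := fun f => if h : ∃ u ∈ f, u ≠ v then g {v, h.choose} else 0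
      have h3 : ∀ f ∈ T.faces, ∀ u ∈ f, v ∈ f → u ≠ v → φ f = g {v, u} := by
        intro f hf u hu hv huv
        have hex := h2 f hf hv
        simp only [φ, dif_pos hex]
        exact h1 f hf _ hex.choose_spec.1 u hu hv hex.choose_spec.2 huv
      by_cases hv : ∃ f ∈ T.faces, v ∈ f
      · obtain ⟨f, hf, hvf⟩ := hv
        rw [← h.const_mul v (φ f)]
        refine Finset.sum_congr rfl fun e he => ?_
        congr 1
        rw [Finset.mem_filter] at he
        obtain ⟨f', g', hf', hg', hfg', hef, heg⟩ := exists_faces_of_edge he.1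
        obtain ⟨u, w, huw, rfl⟩ := Finset.card_eq_two.1 (mem_edges.1 he.1).1
        have hφ : φ f = φ f' := eq_on_star (φ := φ) (v := v) (by
          intro u hu f hf g hg _ h1 h2
          rw [pair_subset] at h1 h2
          rw [h3 f hf u h1.2 h1.1 hu, h3 g hg u h2.2 h2.1 hu]) hf hf' hvf (hef he.2)
        rw [hφ]
        rw [pair_subset] at hef
        have hv' := he.2
        simp only [Finset.mem_insert, Finset.mem_singleton] at hv'
        rcases hv' with rfl | rfl
        · exact (h3 f' hf' w hef.2 hef.1 huw.symm).symm
        · rw [Finset.pair_comm]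
          exact (h3 f' hf' u hef.1 hef.2 huw).symm
      · rw [Finset.sum_eq_zero]
        intro e he
        rw [Finset.mem_filter] at he
        obtain ⟨f, hf, hef⟩ := (mem_edges.1 he.1).2
        exact absurd ⟨f, hf, hef he.2⟩ hv)
  refine ⟨x, fun u huv f hf g hg hfg hef heg => ?_⟩
  have he : ({v, u} : Finset ℕ) ∈ T.edges :=
    pair_mem_edges hf (pair_subset.1 hef).1 (pair_subset.1 hef).2 huv.symm
  rw [hx _ (Finset.mem_filter.2 ⟨he, by simp⟩)]
  simp only [mul_ite, mul_one, mul_zero]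
  rw [← sum_faces_of_edge (mem_edges.1 he).1 hf hg hfg hef heg x, Finset.sum_filter,
    Finset.sum_filter]
  refine Finset.sum_congr rfl fun k _ => ?_
  by_cases hk : ({v, u} : Finset ℕ) ⊆ k
  · rw [if_pos hk, if_pos (pair_subset.1 hk).1]
  · simp [hk]

theorem IsCyc.exists_dual {Z : Finset ℕ → ZMod 2} (h : T.IsCyc Z) :
    ∃ lam ζ, T.Dual lam Z ζ := by
  choose lam hlam using h.exists_local
  refine ⟨lam, fun e => if he : ∃ f ∈ T.faces, e ⊆ f then ∑ v ∈ e, lam v he.choose else 0, ?_, ?_⟩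
  · intro f hf u hu v hv huv
    have he : ∃ f ∈ T.faces, ({u, v} : Finset ℕ) ⊆ f := ⟨f, hf, pair_subset.2 ⟨hu, hv⟩⟩
    simp only [dif_pos he]
    rw [Finset.sum_pair huv]
    obtain ⟨hg, heg⟩ := he.choose_spec
    by_cases hgf : f = he.choose
    · rw [← hgf]
    · have h1 := hlam u v huv.symm f hf _ hg hgf (pair_subset.2 ⟨hu, hv⟩) heg
      have h2 := hlam v u huv f hf _ hg hgf (pair_subset.2 ⟨hv, hu⟩) (by rwa [Finset.pair_comm])
      rw [Finset.pair_comm v u] at h2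
      grind
  · intro u v huv f hf g hg hfg hef heg
    exact hlam u v huv.symm f hf g hg hfg hef heg

theorem IsCocyc.exists_dual {ζ : Finset ℕ → ZMod 2} (h : T.IsCocyc ζ) :
    ∃ lam Z, T.Dual lam Z ζ := by
  have hne : ∀ f ∈ T.faces, f.Nonempty := fun f hf => by
    rw [← Finset.card_pos, T.card_eq_three f hf]; norm_num
  let b : Finset ℕ → ℕ := fun f => if h : f.Nonempty then h.choose else 0
  have hb : ∀ f ∈ T.faces, b f ∈ f := fun f hf => by
    simp only [b, dif_pos (hne f hf)]; exact (hne f hf).choose_spec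
  let lam : ℕ → Finset ℕ → ZMod 2 := fun v f => if v = b f then 0 else ζ {b f, v}
  have key : ∀ f ∈ T.faces, ∀ u ∈ f, ∀ v ∈ f, u ≠ v → ζ {u, v} = lam u f + lam v f := by
    intro f hf u hu v hv huv
    simp only [lam]
    have hbf := hb f hf
    by_cases h1 : u = b f
    · rw [if_pos h1, if_neg (h1 ▸ huv.symm), ← h1, zero_add]
    · by_cases h2 : v = b f
      · rw [if_neg h1, if_pos h2, ← h2, add_zero, Finset.pair_comm]
      · rw [if_neg h1, if_neg h2]
        obtain ⟨x, hx1, hx2, hx3⟩ := exists_third hf hu hv huv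
        obtain rfl : b f = x := by
          rw [hx3] at hbf
          simp only [Finset.mem_insert, Finset.mem_singleton] at hbf
          rw [← hx3] at hbf
          grind
        have := h.face_eq huv hx1.symm hx2.symm (hx3 ▸ hf)
        rw [Finset.pair_comm u (b f), Finset.pair_comm v (b f)] at this
        grind
  refine ⟨lam, fun e => if he : ∃ v, v ∈ e then ∑ f ∈ T.faces with e ⊆ f, lam he.choose f else 0,
    key, ?_⟩
  intro u v huv f hf g hg hfg hef heg
  have he : ∃ x, x ∈ ({u, v} : Finset ℕ) := ⟨u, by simp⟩
  simp only [dif_pos he]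
  rw [sum_faces_of_edge (Finset.card_pair huv) hf hg hfg hef heg]
  have hx := he.choose_spec
  generalize he.choose = x at hx
  simp only [Finset.mem_insert, Finset.mem_singleton] at hx
  rcases hx with rfl | rfl
  · rfl
  · rw [pair_subset] at hef heg
    have h1 := key f hf u hef.1 x hef.2 huv
    have h2 := key g hg u heg.1 x heg.2 huv
    grind

namespace Dual

variable {lam lam' : ℕ → Finset ℕ → ZMod 2} {Z Z' ζ ζ' : Finset ℕ → ZMod 2}

theorem isCocyc (h : T.Dual lam Z ζ) : T.IsCocyc ζ := by
  rw [isCocyc_iff]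
  intro a b c hab hac hbc hf
  rw [h.face _ hf a (by simp) b (by simp) hab, h.face _ hf a (by simp) c (by simp) hac,
    h.face _ hf b (by simp) c (by simp) hbc]
  grind

theorem isCyc (h : T.Dual lam Z ζ) : T.IsCyc Z := by
  intro v
  have h1 : ∑ e ∈ T.edges with v ∈ e, Z e =
      ∑ e ∈ T.edges, ∑ f ∈ T.faces with e ⊆ f, if v ∈ e then lam v f else 0 := by
    rw [Finset.sum_filter]
    refine Finset.sum_congr rfl fun e he => ?_
    by_cases hv : v ∈ e
    · simp only [hv, if_true]
      obtain ⟨u, w, f, g, huw, rfl, hf, hg, hfg, hef, heg⟩ := exists_pair he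
      rw [sum_faces_of_edge (mem_edges.1 he).1 hf hg hfg hef heg]
      simp only [Finset.mem_insert, Finset.mem_singleton] at hv
      rcases hv with rfl | rfl
      · exact h.vert _ _ huw.ne f hf g hg hfg hef heg
      · rw [Finset.pair_comm] at *
        exact h.vert _ _ huw.ne' f hf g hg hfg hef heg
    · simp [hv]
  rw [h1, sum_edges_sum_faces]
  refine Finset.sum_eq_zero fun f hf => ?_
  obtain ⟨a, b, c, hab, hbc, rfl⟩ := exists_lt_lt hf
  rw [sum_edges_of_face hab.ne (hab.trans hbc).ne hbc.ne hf]
  simp only [Finset.mem_insert, Finset.mem_singleton]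
  by_cases h1 : v = a
  · have h2 : v ≠ b := by omega
    have h3 : v ≠ c := by omega
    simp [h1, (h1 ▸ h2), (h1 ▸ h3), zmod_add_self]
  · by_cases h2 : v = b
    · have h3 : v ≠ c := by omega
      simp [h2, (h2 ▸ h3), (h2 ▸ h1), zmod_add_self]
    · by_cases h3 : v = c
      · subst h3
        simp [h1, h2, zmod_add_self]
      · simp [h1, h2, h3]

theorem add (h : T.Dual lam Z ζ) (h' : T.Dual lam' Z' ζ') :
    T.Dual (lam + lam') (Z + Z') (ζ + ζ') where
  face f hf u hu v hv huv := by
    simp only [Pi.add_apply, h.face f hf u hu v hv huv, h'.face f hf u hu v hv huv]; ring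
  vert u v huv f hf g hg hfg hef heg := by
    simp only [Pi.add_apply, h.vert u v huv f hf g hg hfg hef heg,
      h'.vert u v huv f hf g hg hfg hef heg]; ring

theorem cob (U : ℕ → ZMod 2) : T.Dual (fun v _ => U v) 0 (cob U) where
  face f hf u hu v hv huv := cob_pair U huv
  vert u v huv f hf g hg hfg hef heg := by simp [zmod_add_self]

theorem add_cob (h : T.Dual lam Z ζ) (U : ℕ → ZMod 2) :
    T.Dual (fun v f => lam v f + U v) Z (ζ + Triangulation.cob U) := by
  have := h.add (cob U)
  rwa [add_zero] at this

/-- Symmetry of the intersection form. -/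
theorem pr_comm (h : T.Dual lam Z ζ) (h' : T.Dual lam' Z' ζ') : T.pr ζ Z' = T.pr ζ' Z := by
  suffices H : ∑ e ∈ T.edges, (ζ e * Z' e + ζ' e * Z e) = 0 by
    rw [Finset.sum_add_distrib] at H
    have H' : T.pr ζ Z' + T.pr ζ' Z = 0 := H
    grind
  let br : Finset ℕ → Finset ℕ → ZMod 2 := fun e f =>
    (∑ v ∈ e, lam v f) * (∑ v ∈ e, lam' v f) + ∑ v ∈ e, lam v f * lam' v f
  have h1 : ∀ e ∈ T.edges, ζ e * Z' e + ζ' e * Z e = ∑ f ∈ T.faces with e ⊆ f, br e f := by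
    intro e he
    obtain ⟨u, w, f, g, huw, rfl, hf, hg, hfg, hef, heg⟩ := exists_pair he
    rw [sum_faces_of_edge (mem_edges.1 he).1 hf hg hfg hef heg]
    simp only [br, Finset.sum_pair huw.ne]
    have a1 := h.vert u w huw.ne f hf g hg hfg hef heg
    have a2 := h'.vert u w huw.ne f hf g hg hfg hef heg
    rw [pair_subset] at hef heg
    have b1 := h.face f hf u hef.1 w hef.2 huw.ne
    have b2 := h.face g hg u heg.1 w heg.2 huw.ne
    have b3 := h'.face f hf u hef.1 w hef.2 huw.ne
    have b4 := h'.face g hg u heg.1 w heg.2 huw.ne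
    rw [a1, a2, b1, b3]
    rw [b1] at b2
    rw [b3] at b4
    generalize lam u f = x1 at *
    generalize lam w f = x2 at *
    generalize lam u g = x3 at *
    generalize lam w g = x4 at *
    generalize lam' u f = y1 at *
    generalize lam' w f = y2 at *
    generalize lam' u g = y3 at *
    generalize lam' w g = y4 at *
    obtain rfl : x4 = x1 + x2 + x3 := by grind
    obtain rfl : y4 = y1 + y2 + y3 := by grind
    clear a1 a2 b1 b2 b3 b4
    grind
  rw [Finset.sum_congr rfl h1, sum_edges_sum_faces]
  have h2 : ∀ f ∈ T.faces, ∑ e ∈ T.edges with e ⊆ f, br e f =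
      ∑ e ∈ T.edges with e ⊆ f, ζ e * ζ' e := by
    intro f hf
    obtain ⟨a, b, c, hab, hbc, rfl⟩ := exists_lt_lt hf
    have hac := hab.trans hbc
    rw [sum_edges_of_face hab.ne hac.ne hbc.ne hf, sum_edges_of_face hab.ne hac.ne hbc.ne hf]
    simp only [br, Finset.sum_pair hab.ne, Finset.sum_pair hac.ne, Finset.sum_pair hbc.ne]
    rw [h.face _ hf a (by simp) b (by simp) hab.ne, h.face _ hf a (by simp) c (by simp) hac.ne,
      h.face _ hf b (by simp) c (by simp) hbc.ne, h'.face _ hf a (by simp) b (by simp) hab.ne,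
      h'.face _ hf a (by simp) c (by simp) hac.ne, h'.face _ hf b (by simp) c (by simp) hbc.ne]
    grind
  rw [Finset.sum_congr rfl h2, ← sum_edges_sum_faces fun e _ => ζ e * ζ' e]
  refine Finset.sum_eq_zero fun e he => ?_
  obtain ⟨f, g, hf, hg, hfg, hef, heg⟩ := exists_faces_of_edge he
  rw [sum_faces_of_edge (mem_edges.1 he).1 hf hg hfg hef heg, zmod_add_self]

end Dual

/-- Whether the edge `e` joins the least and the greatest vertex of the triangle `f`. -/
noncomputable def longEdge (e f : Finset ℕ) : ZMod 2 :=
  if ∃ x ∈ f, x ∉ e ∧ (∃ y ∈ e, y < x) ∧ ∃ y ∈ e, x < y then 1 else 0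

theorem longEdge_of_lt {a b c : ℕ} (hab : a < b) (hbc : b < c) :
    longEdge {a, b} {a, b, c} = 0 ∧ longEdge {b, c} {a, b, c} = 0 ∧
      longEdge {a, c} {a, b, c} = 1 := by
  refine ⟨if_neg ?_, if_neg ?_, if_pos ?_⟩
  · simp; omega
  · simp; omega
  · refine ⟨b, by simp, by simp; omega, ⟨a, by simp, hab⟩, ⟨c, by simp, hbc⟩⟩

/-- The cycle measuring the incompatibility of the orientations of the faces given by the order
of the vertices. -/
noncomputable def orCyc (T : Triangulation) (e : Finset ℕ) : ZMod 2 := 1 + T.bd (longEdge e) e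

/-- The tail of the edge `e` for the orientation of `f` given by the order of the vertices. -/
noncomputable def tail (lam : ℕ → Finset ℕ → ZMod 2) (e f : Finset ℕ) : ZMod 2 :=
  lam (sInf (e : Set ℕ)) f + longEdge e f * ∑ v ∈ e, lam v f

theorem sInf_coe_pair {a b : ℕ} (h : a < b) :
    sInf ((({a, b} : Finset ℕ)) : Set ℕ) = a := by
  rw [Finset.coe_pair, csInf_pair]
  exact inf_eq_left.2 h.le

theorem Dual.pr_orCyc {lam : ℕ → Finset ℕ → ZMod 2} {Z ζ : Finset ℕ → ZMod 2}
    (h : T.Dual lam Z ζ) : T.pr ζ Z = T.pr ζ T.orCyc := by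
  have h1 : ∀ e ∈ T.edges, ζ e * Z e + ζ e * T.orCyc e =
      ζ e + ∑ f ∈ T.faces with e ⊆ f, ζ e * tail lam e f := by
    intro e he
    obtain ⟨u, w, f, g, huw, rfl, hf, hg, hfg, hef, heg⟩ := exists_pair he
    have a1 := h.vert u w huw.ne f hf g hg hfg hef heg
    rw [sum_faces_of_edge (mem_edges.1 he).1 hf hg hfg hef heg, orCyc,
      bd_pair (mem_edges.1 he).1 hf hg hfg hef heg]
    simp only [tail, sInf_coe_pair huw, Finset.sum_pair huw.ne]
    rw [pair_subset] at hef heg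
    rw [← h.face f hf u hef.1 w hef.2 huw.ne, ← h.face g hg u heg.1 w heg.2 huw.ne, a1]
    have : ∀ z : ZMod 2, z * z = z := by decide
    have := this (ζ {u, w})
    grind
  let N : Finset ℕ → ℕ := fun e => if ζ e = 1 then 1 else 0
  let C : Finset ℕ → ℕ := fun f => if ∃ e ∈ T.edges, e ⊆ f ∧ ζ e = 1 then 1 else 0
  have h2 : ∀ f ∈ T.faces, ∑ e ∈ T.edges with e ⊆ f, N e = 2 * C f ∧
      ∑ e ∈ T.edges with e ⊆ f, ζ e * tail lam e f = C f := by
    intro f hf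
    obtain ⟨a, b, c, hab, hbc, rfl⟩ := exists_lt_lt hf
    have hac := hab.trans hbc
    have hC : (∃ e ∈ T.edges, e ⊆ ({a, b, c} : Finset ℕ) ∧ ζ e = 1) ↔
        ζ {a, b} = 1 ∨ ζ {a, c} = 1 ∨ ζ {b, c} = 1 := by
      have h' : ∀ e, (e ∈ T.edges ∧ e ⊆ ({a, b, c} : Finset ℕ) ∧ ζ e = 1) ↔
          e ∈ T.edges.filter (fun e => e ⊆ ({a, b, c} : Finset ℕ)) ∧ ζ e = 1 := by
        intro e; rw [Finset.mem_filter, and_assoc]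
      simp only [h', edges_of_face hab.ne hac.ne hbc.ne hf]
      simp
    simp only [C, hC]
    rw [sum_edges_of_face hab.ne hac.ne hbc.ne hf, sum_edges_of_face hab.ne hac.ne hbc.ne hf]
    obtain ⟨l1, l2, l3⟩ := longEdge_of_lt hab hbc
    simp only [tail, sInf_coe_pair hab, sInf_coe_pair hac, sInf_coe_pair hbc, l1, l2, l3,
      Finset.sum_pair hac.ne, N, zero_mul, add_zero]
    rw [h.face _ hf a (by simp) b (by simp) hab.ne, h.face _ hf a (by simp) c (by simp) hac.ne,
      h.face _ hf b (by simp) c (by simp) hbc.ne]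
    generalize lam a _ = x
    generalize lam b _ = y
    generalize lam c _ = z
    revert x y z
    decide
  have h3 : ∑ e ∈ T.edges, N e = ∑ f ∈ T.faces, C f := by
    have : ∑ e ∈ T.edges, 2 * N e = ∑ f ∈ T.faces, 2 * C f := by
      rw [← Finset.sum_congr rfl fun f hf => (h2 f hf).1, ← sum_edges_sum_faces fun e _ => N e]
      refine Finset.sum_congr rfl fun e he => ?_
      obtain ⟨f, g, hf, hg, hfg, hef, heg⟩ := exists_faces_of_edge he
      rw [sum_faces_of_edge (mem_edges.1 he).1 hf hg hfg hef heg, two_mul]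
    rw [← Finset.mul_sum, ← Finset.mul_sum] at this
    omega
  have h4 : ∑ e ∈ T.edges, ζ e = ∑ f ∈ T.faces, (C f : ZMod 2) := by
    rw [← Nat.cast_sum, ← h3, Nat.cast_sum]
    refine Finset.sum_congr rfl fun e _ => ?_
    simp only [N]
    generalize ζ e = z
    revert z; decide
  have h5 := Finset.sum_congr rfl h1
  rw [Finset.sum_add_distrib, Finset.sum_add_distrib, sum_edges_sum_faces,
    Finset.sum_congr rfl fun f hf => (h2 f hf).2, h4, zmod_add_self] at h5
  have h6 : T.pr ζ Z + T.pr ζ T.orCyc = 0 := h5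
  grind

theorem isCyc_orCyc : T.IsCyc T.orCyc := by
  intro v
  have h := (Dual.cob (T := T) (fun u => if u = v then 1 else 0)).pr_orCyc
  have h0 : T.pr (cob fun u => if u = v then 1 else 0) 0 = 0 := by simp [pr]
  rw [h0] at h
  rw [h, pr, Finset.sum_filter]
  refine Finset.sum_congr rfl fun e _ => ?_
  simp [cob]

theorem orientable_of_orCyc_eq_bd {X : Finset ℕ → ZMod 2}
    (h : ∀ e ∈ T.edges, T.orCyc e = T.bd X e) : T.Orientable := by
  have hex : ∀ f ∈ T.faces, ∃ t : ℕ × ℕ × ℕ, ({t.1, t.2.1, t.2.2} : Finset ℕ) = f ∧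
      ∀ u v, (u, v) ∈ dedges t → u ≠ v ∧ u ∈ f ∧ v ∈ f ∧
        longEdge {u, v} f + X f = if u < v then 0 else 1 := by
    intro f hf
    obtain ⟨a, b, c, hab, hbc, rfl⟩ := exists_lt_lt hf
    have hac := hab.trans hbc
    obtain ⟨l1, l2, l3⟩ := longEdge_of_lt hab hbc
    have hX : ∀ z : ZMod 2, z = 0 ∨ z = 1 := by decide
    rcases hX (X {a, b, c}) with hX | hX
    · refine ⟨(a, b, c), rfl, ?_⟩
      intro u v huv
      simp only [dedges, Finset.mem_insert, Finset.mem_singleton, Prod.mk.injEq] at huv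
      rcases huv with ⟨rfl, rfl⟩ | ⟨rfl, rfl⟩ | ⟨rfl, rfl⟩
      · simp [l1, hX, hab, hab.ne]
      · simp [l2, hX, hbc, hbc.ne]
      · rw [Finset.pair_comm u v, l3]
        simp [hX, hac.le, hac.ne']
    · have h2 : (1 : ZMod 2) + 1 = 0 := rfl
      refine ⟨(c, b, a), by ext; simp; tauto, ?_⟩
      intro u v huv
      simp only [dedges, Finset.mem_insert, Finset.mem_singleton, Prod.mk.injEq] at huv
      rcases huv with ⟨rfl, rfl⟩ | ⟨rfl, rfl⟩ | ⟨rfl, rfl⟩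
      · rw [Finset.pair_comm u v, l2]
        simp [hX, hbc.le, hbc.ne']
      · rw [Finset.pair_comm u v, l1]
        simp [hX, hab.le, hab.ne']
      · simp [l3, hX, hac, hac.ne, h2]
  choose! σ hσ using hex
  refine ⟨σ, fun f hf => (hσ f hf).1, fun f hf g hg hfg => ?_⟩
  rw [Finset.disjoint_left]
  rintro ⟨u, v⟩ h1 h2
  obtain ⟨huv, a1, a2, a3⟩ := (hσ f hf).2 u v h1
  obtain ⟨-, b1, b2, b3⟩ := (hσ g hg).2 u v h2
  have he := pair_mem_edges hf a1 a2 huv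
  have := h _ he
  rw [orCyc, bd_pair (mem_edges.1 he).1 hf hg hfg (pair_subset.2 ⟨a1, a2⟩)
    (pair_subset.2 ⟨b1, b2⟩), bd_pair (mem_edges.1 he).1 hf hg hfg (pair_subset.2 ⟨a1, a2⟩)
    (pair_subset.2 ⟨b1, b2⟩)] at this
  grind

section Dimension

variable {α β γ : Type*} (I : Finset α) (J : Finset β) (K : Finset γ) (M : α → β → ZMod 2)
  (N : γ → β → ZMod 2)

/-- Extension by zero of a function on a finset. -/
noncomputable def ext0 {α : Type*} {I : Finset α} (x : I → ZMod 2) (i : α) : ZMod 2 :=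
  if h : i ∈ I then x ⟨i, h⟩ else 0

theorem ext0_coe {α : Type*} {I : Finset α} (x : I → ZMod 2) (i : I) : ext0 x i = x i := by
  simp [ext0]

/-- The matrix with rows in `I` and columns in `J`. -/
def mat : Matrix I J (ZMod 2) := fun i j => M i j

theorem mat_vecMul (x : α → ZMod 2) (j : J) :
    Matrix.vecMul (fun i : I => x i) (mat I J M) j = ∑ i ∈ I, x i * M i j := by
  rw [← Finset.sum_coe_sort I]; rfl

theorem mat_mulVec (z : β → ZMod 2) (k : K) :
    Matrix.mulVec (mat K J N) (fun j : J => z j) k = ∑ j ∈ J, z j * N k j := by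
  rw [← Finset.sum_coe_sort J]
  exact Finset.sum_congr rfl fun j _ => mul_comm _ _

theorem finrank_ker_add :
    Module.finrank (ZMod 2) (LinearMap.ker (mat K J N).mulVecLin) + (I.card + K.card) =
      Module.finrank (ZMod 2) (LinearMap.range (mat I J M).vecMulLinear) + J.card +
      (Module.finrank (ZMod 2) (LinearMap.ker (mat I J M).vecMulLinear) +
      Module.finrank (ZMod 2) (LinearMap.ker (mat K J N).vecMulLinear)) := by
  have h1 := LinearMap.finrank_range_add_finrank_ker (mat K J N).mulVecLin
  have h2 := LinearMap.finrank_range_add_finrank_ker (mat I J M).vecMulLinear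
  have h3 := LinearMap.finrank_range_add_finrank_ker (mat K J N).vecMulLinear
  have h4 : Module.finrank (ZMod 2) (LinearMap.range (mat K J N).vecMulLinear) =
      Module.finrank (ZMod 2) (LinearMap.range (mat K J N).mulVecLin) := by
    have := Matrix.rank_transpose (mat K J N)
    rw [Matrix.rank, Matrix.rank, Matrix.mulVecLin_transpose] at this
    exact this
  simp only [Module.finrank_fintype_fun_eq_card, Fintype.card_coe] at h1 h2 h3
  omega

variable {I J K M N}

theorem range_le_ker (hMN : ∀ i ∈ I, ∀ k ∈ K, ∑ j ∈ J, M i j * N k j = 0) :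
    LinearMap.range (mat I J M).vecMulLinear ≤ LinearMap.ker (mat K J N).mulVecLin := by
  rintro _ ⟨x, rfl⟩
  rw [LinearMap.mem_ker]
  simp only [Matrix.mulVecLin_apply, Matrix.vecMulLinear_apply]
  ext k
  rw [← Matrix.vecMul_transpose, Matrix.vecMul_vecMul]
  have : mat I J M * (mat K J N).transpose = 0 := by
    ext i k
    rw [Matrix.mul_apply, Matrix.zero_apply, ← hMN i i.2 k k.2, ← Finset.sum_coe_sort J]
    rfl
  rw [this]; simp

theorem finrank_le_one_of_const {V : Type*} (L : Submodule (ZMod 2) (V → ZMod 2)) [Finite V]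
    (h : ∀ z ∈ L, ∀ k k', z k = z k') : Module.finrank (ZMod 2) L ≤ 1 := by
  rw [finrank_le_one_iff]
  by_cases hL : (fun _ => 1 : V → ZMod 2) ∈ L
  · refine ⟨⟨_, hL⟩, fun w => ?_⟩
    by_cases hV : Nonempty V
    · obtain ⟨v⟩ := hV
      refine ⟨w.1 v, ?_⟩
      ext k
      simp [h w.1 w.2 v k]
    · refine ⟨0, ?_⟩
      ext k
      exact absurd ⟨k⟩ hV
  · refine ⟨0, fun w => ⟨0, ?_⟩⟩
    ext k
    have hw : ∀ k', w.1 k' = w.1 k := fun k' => h _ w.2 _ _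
    have hX : ∀ z : ZMod 2, z = 0 ∨ z = 1 := by decide
    rcases hX (w.1 k) with h0 | h0
    · simp [h0]
    · refine absurd ?_ hL
      have : w.1 = fun _ => 1 := funext fun k' => (hw k').trans h0
      rw [← this]; exact w.2

theorem mem_ker_left {x : I → ZMod 2} (hx : x ∈ LinearMap.ker (mat I J M).vecMulLinear) (j : β)
    (hj : j ∈ J) : ∑ i ∈ I, ext0 x i * M i j = 0 := by
  rw [LinearMap.mem_ker] at hx
  have := congrFun hx ⟨j, hj⟩
  rw [← mat_vecMul I J M (ext0 x) ⟨j, hj⟩]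
  simp only [ext0_coe]
  exact this

/-- A disc has no first cohomology relative to its boundary. -/
theorem exists_of_euler_one (hMN : ∀ i ∈ I, ∀ k ∈ K, ∑ j ∈ J, M i j * N k j = 0)
    (hM : ∀ x : α → ZMod 2, (∀ j ∈ J, ∑ i ∈ I, x i * M i j = 0) → ∀ i ∈ I, x i = 0)
    (hN : ∀ z : γ → ZMod 2, (∀ j ∈ J, ∑ k ∈ K, z k * N k j = 0) →
      ∀ k ∈ K, ∀ k' ∈ K, z k = z k')
    (hc : I.card + K.card = J.card + 1) {ζ : β → ZMod 2}
    (hζ : ∀ k ∈ K, ∑ j ∈ J, ζ j * N k j = 0) :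
    ∃ x : α → ZMod 2, ∀ j ∈ J, ζ j = ∑ i ∈ I, x i * M i j := by
  have h1 := finrank_ker_add I J K M N
  have h2 : LinearMap.ker (mat I J M).vecMulLinear = ⊥ := by
    rw [eq_bot_iff]
    intro x hx
    rw [Submodule.mem_bot]
    ext i
    rw [← ext0_coe x i]
    exact hM _ (mem_ker_left hx) i i.2
  rw [h2, finrank_bot] at h1
  have h3 : Module.finrank (ZMod 2) (LinearMap.ker (mat K J N).vecMulLinear) ≤ 1 := by
    apply finrank_le_one_of_const
    intro z hz k k'
    rw [← ext0_coe z k, ← ext0_coe z k']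
    exact hN _ (mem_ker_left hz) k k.2 k' k'.2
  have h4 := Submodule.eq_of_le_of_finrank_le (range_le_ker hMN) (by omega)
  have h5 : (fun j : J => ζ j) ∈ LinearMap.ker (mat K J N).mulVecLin := by
    rw [LinearMap.mem_ker, Matrix.mulVecLin_apply]
    ext k
    rw [mat_mulVec]; exact hζ k k.2
  rw [← h4] at h5
  obtain ⟨x, hx⟩ := h5
  refine ⟨ext0 x, fun j hj => ?_⟩
  rw [← mat_vecMul I J M (ext0 x) ⟨j, hj⟩]
  simp only [ext0_coe]
  exact (congrFun hx ⟨j, hj⟩).symm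

theorem finrank_eq_one_of_const {V : Type*} (L : Submodule (ZMod 2) (V → ZMod 2)) [Finite V]
    [Nonempty V] (h : ∀ z ∈ L, ∀ k k', z k = z k') (h1 : (fun _ => 1 : V → ZMod 2) ∈ L) :
    Module.finrank (ZMod 2) L = 1 := by
  apply le_antisymm (finrank_le_one_of_const L h)
  rw [Nat.one_le_iff_ne_zero, Ne, Submodule.finrank_eq_zero]
  rintro rfl
  rw [Submodule.mem_bot] at h1
  obtain ⟨v⟩ := ‹Nonempty V›
  exact one_ne_zero (congrFun h1 v)

theorem finrank_eq_add_two (hI : I.Nonempty) (hK : K.Nonempty)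
    (hM : ∀ x : α → ZMod 2, (∀ j ∈ J, ∑ i ∈ I, x i * M i j = 0) →
      ∀ i ∈ I, ∀ i' ∈ I, x i = x i')
    (hM1 : ∀ j ∈ J, ∑ i ∈ I, M i j = 0)
    (hN : ∀ z : γ → ZMod 2, (∀ j ∈ J, ∑ k ∈ K, z k * N k j = 0) →
      ∀ k ∈ K, ∀ k' ∈ K, z k = z k')
    (hN1 : ∀ j ∈ J, ∑ k ∈ K, N k j = 0)
    (hc : I.card + K.card = J.card) :
    Module.finrank (ZMod 2) (LinearMap.ker (mat K J N).mulVecLin) =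
      Module.finrank (ZMod 2) (LinearMap.range (mat I J M).vecMulLinear) + 2 := by
  have h1 := finrank_ker_add I J K M N
  have := hI.to_subtype
  have := hK.to_subtype
  rw [finrank_eq_one_of_const (LinearMap.ker (mat I J M).vecMulLinear),
    finrank_eq_one_of_const (LinearMap.ker (mat K J N).vecMulLinear)] at h1
  · omega
  · intro z hz k k'
    rw [← ext0_coe z k, ← ext0_coe z k']
    exact hN _ (mem_ker_left hz) k k.2 k' k'.2
  · rw [LinearMap.mem_ker]
    ext j
    rw [Matrix.vecMulLinear_apply, mat_vecMul K J N (fun _ => 1) j]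
    simp [hN1 j j.2]
  · intro z hz k k'
    rw [← ext0_coe z k, ← ext0_coe z k']
    exact hM _ (mem_ker_left hz) k k.2 k' k'.2
  · rw [LinearMap.mem_ker]
    ext j
    rw [Matrix.vecMulLinear_apply, mat_vecMul I J M (fun _ => 1) j]
    simp [hM1 j j.2]

theorem exists_not_mem_sup {V : Type*} [AddCommGroup V] [Module (ZMod 2) V] [FiniteDimensional (ZMod 2) V]
    {B C : Submodule (ZMod 2) V}
    (h : Module.finrank (ZMod 2) C = Module.finrank (ZMod 2) B + 2) (w : V) :
    ∃ z ∈ C, z ∉ B ⊔ Submodule.span (ZMod 2) {w} := by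
  by_contra! hle
  have h1 := Submodule.finrank_mono (show C ≤ _ from hle)
  have h2 := Submodule.finrank_add_le_finrank_add_finrank B (Submodule.span (ZMod 2) {w})
  have h3 := finrank_span_le_card (R := ZMod 2) ({w} : Set V)
  simp at h3
  omega

theorem le_sup_sup {V : Type*} [AddCommGroup V] [Module (ZMod 2) V] [FiniteDimensional (ZMod 2) V]
    {B C : Submodule (ZMod 2) V}
    (h : Module.finrank (ZMod 2) C = Module.finrank (ZMod 2) B + 2) (hBC : B ≤ C) {w w' : V}
    (hw : w ∈ C) (hw' : w' ∈ C) (h1 : w ∉ B) (h2 : w' ∉ B ⊔ Submodule.span (ZMod 2) {w}) :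
    C = B ⊔ Submodule.span (ZMod 2) {w} ⊔ Submodule.span (ZMod 2) {w'} := by
  symm
  have hlt1 : B < B ⊔ Submodule.span (ZMod 2) {w} := by
    refine lt_of_le_of_ne le_sup_left fun he => h1 ?_
    rw [he]; exact Submodule.mem_sup_right (Submodule.mem_span_singleton_self w)
  have hlt2 : B ⊔ Submodule.span (ZMod 2) {w} <
      B ⊔ Submodule.span (ZMod 2) {w} ⊔ Submodule.span (ZMod 2) {w'} := by
    refine lt_of_le_of_ne le_sup_left fun he => h2 ?_
    rw [he]; exact Submodule.mem_sup_right (Submodule.mem_span_singleton_self w')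
  have h3 := Submodule.finrank_lt_finrank_of_lt hlt1
  have h4 := Submodule.finrank_lt_finrank_of_lt hlt2
  apply Submodule.eq_of_le_of_finrank_le
  · simp only [sup_le_iff, Submodule.span_singleton_le_iff_mem]
    exact ⟨⟨hBC, hw⟩, hw'⟩
  · omega

end Dimension

theorem sum_incidence {v : ℕ} {f : Finset ℕ} (hf : f ∈ T.faces) :
    ∑ e ∈ T.edges, (if v ∈ e then 1 else 0 : ZMod 2) * (if e ⊆ f then 1 else 0) = 0 := by
  have := isCocyc_cob (T := T) (fun u => if u = v then 1 else 0) f hf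
  rw [Finset.sum_filter] at this
  refine Eq.trans ?_ this
  exact Finset.sum_congr rfl fun e _ => by simp [cob]

theorem sum_mul_mem (x : ℕ → ZMod 2) {e : Finset ℕ} (he : e ∈ T.edges) :
    ∑ v ∈ T.verts, x v * (if v ∈ e then 1 else 0) = cob x e :=
  (cob_eq_sum he).symm

theorem sum_mul_subset (x : Finset ℕ → ZMod 2) (e : Finset ℕ) :
    ∑ f ∈ T.faces, x f * (if e ⊆ f then 1 else 0) = T.bd x e := by
  rw [bd, Finset.sum_filter]; simp

theorem cocyc_finrank (hT : T.euler = 0) :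
    Module.finrank (ZMod 2) (LinearMap.ker
        (mat T.faces T.edges fun f e => if e ⊆ f then 1 else 0).mulVecLin) =
      Module.finrank (ZMod 2) (LinearMap.range
        (mat T.verts T.edges fun v e => if v ∈ e then 1 else 0).vecMulLinear) + 2 := by
  have hz : ∀ x y : ZMod 2, x + y = 0 → x = y := by decide
  apply finrank_eq_add_two
  · obtain ⟨f, hf⟩ := T.faces_nonempty
    obtain ⟨a, b, c, -, -, rfl⟩ := exists_lt_lt hf
    exact ⟨a, mem_verts.2 ⟨_, hf, by simp⟩⟩
  · exact T.faces_nonempty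
  · intro x hx i hi i' hi'
    refine eq_on_verts (T := T) (fun u v huv => ?_) hi hi'
    have := hx _ huv
    rw [sum_mul_mem x huv, cob_pair x (ne_of_pair_mem_edges huv)] at this
    exact hz _ _ this
  · intro e he
    have := sum_mul_mem (T := T) (fun _ => 1) he
    simp only [one_mul] at this
    rw [this]
    simp only [cob, Finset.sum_const, (mem_edges.1 he).1]
    rfl
  · intro x hx f hf g hg
    refine eq_on_faces (T := T) (fun f hf g hg hfg he => ?_) hf hg
    have := hx _ he
    rw [sum_mul_subset x, bd_pair (mem_edges.1 he).1 hf hg hfg Finset.inter_subset_left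
      Finset.inter_subset_right] at this
    exact hz _ _ this
  · intro e he
    have := sum_mul_subset (T := T) (fun _ => 1) e
    simp only [one_mul] at this
    rw [this]
    obtain ⟨f, g, hf, hg, hfg, hef, heg⟩ := exists_faces_of_edge he
    rw [bd_pair (mem_edges.1 he).1 hf hg hfg hef heg]
    rfl
  · have h : (T.verts.card : ℤ) - T.edges.card + T.faces.card = 0 := hT
    omega

theorem mem_cocyc_ker {ζ : Finset ℕ → ZMod 2} :
    (fun e : T.edges => ζ e) ∈ LinearMap.ker
        (mat T.faces T.edges fun f e => if e ⊆ f then 1 else 0).mulVecLin ↔ T.IsCocyc ζ := by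
  rw [LinearMap.mem_ker, Matrix.mulVecLin_apply, funext_iff, Subtype.forall]
  refine forall₂_congr fun f hf => ?_
  rw [mat_mulVec, Finset.sum_filter]
  simp

theorem mem_cob_range {ζ : Finset ℕ → ZMod 2} :
    (fun e : T.edges => ζ e) ∈ LinearMap.range
        (mat T.verts T.edges fun v e => if v ∈ e then 1 else 0).vecMulLinear ↔
      ∃ U, ∀ e ∈ T.edges, ζ e = cob U e := by
  constructor
  · rintro ⟨x, hx⟩
    refine ⟨ext0 x, fun e he => ?_⟩
    rw [← sum_mul_mem _ he, ← mat_vecMul _ _ (fun v e => if v ∈ e then 1 else 0) _ ⟨e, he⟩]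
    simp only [ext0_coe]
    exact (congrFun hx ⟨e, he⟩).symm
  · rintro ⟨U, hU⟩
    refine ⟨fun v => U v, ?_⟩
    ext e
    rw [Matrix.vecMulLinear_apply, mat_vecMul, sum_mul_mem _ e.2, hU e e.2]

theorem mem_cob_sup {ζ w : Finset ℕ → ZMod 2} :
    (fun e : T.edges => ζ e) ∈ LinearMap.range
        (mat T.verts T.edges fun v e => if v ∈ e then 1 else 0).vecMulLinear ⊔
        Submodule.span (ZMod 2) {fun e : T.edges => w e} ↔
      ∃ U c, ∀ e ∈ T.edges, ζ e = cob U e + c * w e := by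
  rw [Submodule.mem_sup]
  constructor
  · rintro ⟨y, hy, z, hz, h⟩
    obtain ⟨c, rfl⟩ := Submodule.mem_span_singleton.1 hz
    obtain ⟨U, hU⟩ := mem_cob_range.1 ((by
      convert hy using 1
      ext e; exact ext0_coe y e) : (fun e : T.edges => ext0 y e) ∈ _)
    refine ⟨U, c, fun e he => ?_⟩
    rw [← hU e he]
    have := congrFun h ⟨e, he⟩
    simp only [Pi.add_apply, Pi.smul_apply, smul_eq_mul] at this
    rw [← this]
    congr 1
    exact (ext0_coe y ⟨e, he⟩).symm
  · rintro ⟨U, c, h⟩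
    refine ⟨_, mem_cob_range.2 ⟨U, fun _ _ => rfl⟩, _, Submodule.mem_span_singleton.2 ⟨c, rfl⟩, ?_⟩
    ext e
    simp [h e e.2]

theorem exists_cocyc_indep (hT : T.euler = 0) (w : Finset ℕ → ZMod 2) :
    ∃ ζ, T.IsCocyc ζ ∧ ∀ U c, ¬ ∀ e ∈ T.edges, ζ e = cob U e + c * w e := by
  obtain ⟨z, hz, h⟩ := exists_not_mem_sup (cocyc_finrank hT) (fun e : T.edges => w e)
  have hz' : z = fun e : T.edges => ext0 z e := by ext e; rw [ext0_coe]
  rw [hz'] at hz h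
  rw [mem_cocyc_ker] at hz
  rw [mem_cob_sup] at h
  exact ⟨ext0 z, hz, fun U c hc => h ⟨U, c, hc⟩⟩

theorem cocyc_span (hT : T.euler = 0) {w w' : Finset ℕ → ZMod 2} (hw : T.IsCocyc w)
    (hw' : T.IsCocyc w') (h1 : ∀ U, ¬ ∀ e ∈ T.edges, w e = cob U e)
    (h2 : ∀ U c, ¬ ∀ e ∈ T.edges, w' e = cob U e + c * w e)
    {ζ : Finset ℕ → ZMod 2} (hζ : T.IsCocyc ζ) :
    ∃ U c c', ∀ e ∈ T.edges, ζ e = cob U e + c * w e + c' * w' e := by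
  have hle : LinearMap.range
        (mat T.verts T.edges fun v e => if v ∈ e then 1 else 0).vecMulLinear ≤ LinearMap.ker
        (mat T.faces T.edges fun f e => if e ⊆ f then 1 else 0).mulVecLin :=
    range_le_ker fun i _ k hk => sum_incidence hk
  have h := le_sup_sup (cocyc_finrank hT) hle (mem_cocyc_ker.2 hw) (mem_cocyc_ker.2 hw')
    (fun h => by obtain ⟨U, hU⟩ := mem_cob_range.1 h; exact h1 U hU)
    (fun h => by obtain ⟨U, c, hU⟩ := mem_cob_sup.1 h; exact h2 U c hU)
  have h3 := mem_cocyc_ker.2 hζ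
  rw [h, Submodule.mem_sup] at h3
  obtain ⟨y, hy, z, hz, h3⟩ := h3
  obtain ⟨c', rfl⟩ := Submodule.mem_span_singleton.1 hz
  have hy' : y = fun e : T.edges => ext0 y e := by ext e; rw [ext0_coe]
  rw [hy'] at hy
  obtain ⟨U, c, hU⟩ := mem_cob_sup.1 hy
  refine ⟨U, c, c', fun e he => ?_⟩
  rw [← hU e he]
  have := congrFun h3 ⟨e, he⟩
  simp only [Pi.add_apply, Pi.smul_apply, smul_eq_mul] at this
  rw [← this]
  congr 1
  exact (ext0_coe y ⟨e, he⟩).symm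

theorem pr_eq_of_eq {Z : Finset ℕ → ZMod 2} (hZ : T.IsCyc Z) {w ζ : Finset ℕ → ZMod 2}
    {U : ℕ → ZMod 2} {c : ZMod 2} (h : ∀ e ∈ T.edges, ζ e = cob U e + c * w e) :
    T.pr ζ Z = c * T.pr w Z := by
  have h1 := hZ.pr_cob U
  rw [pr] at h1 ⊢
  rw [Finset.sum_congr rfl fun e he => by rw [h e he, add_mul, mul_assoc],
    Finset.sum_add_distrib, h1, zero_add, pr, Finset.mul_sum]

theorem pr_eq_of_eq₂ {Z : Finset ℕ → ZMod 2} (hZ : T.IsCyc Z) {w w' ζ : Finset ℕ → ZMod 2}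
    {U : ℕ → ZMod 2} {c c' : ZMod 2}
    (h : ∀ e ∈ T.edges, ζ e = cob U e + c * w e + c' * w' e) :
    T.pr ζ Z = c * T.pr w Z + c' * T.pr w' Z := by
  have h1 := pr_eq_of_eq hZ (ζ := fun e => cob U e + c * w e) fun _ _ => rfl
  rw [← h1]
  simp only [pr, Finset.mul_sum, ← Finset.sum_add_distrib]
  exact Finset.sum_congr rfl fun e he => by rw [h e he]; ring

theorem IsCocyc.const_mul {w : Finset ℕ → ZMod 2} (hw : T.IsCocyc w) (c : ZMod 2) :
    T.IsCocyc fun e => c * w e := by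
  intro f hf
  rw [← Finset.mul_sum, hw f hf, mul_zero]

/-- The orientation class of a triangulated Klein bottle. -/
structure IsOrClass (T : Triangulation) (w : Finset ℕ → ZMod 2) : Prop where
  cocyc : T.IsCocyc w
  pr_self : ∀ lam Z ζ, T.Dual lam Z ζ → T.pr w Z = T.pr ζ Z
  pr_orCyc : T.pr w T.orCyc = 0
  pr_orCyc_right : ∀ lam Z ζ, T.Dual lam Z ζ → T.pr ζ T.orCyc = T.pr ζ Z
  exists_odd : ∃ Z, T.IsCyc Z ∧ T.pr w Z = 1
  killed : ∀ lam A α, T.Dual lam A α → T.pr α A = 1 → ∀ Z, T.IsCyc Z → T.pr α Z = 0 →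
    T.pr w Z = 0 → ∀ ζ, T.IsCocyc ζ → T.pr ζ Z = 0

theorem exists_isOrClass (hT : T.IsN 2) : ∃ w, T.IsOrClass w := by
  have hχ : T.euler = 0 := by rw [hT.1]; norm_num
  have hX : ∀ z : ZMod 2, z = 0 ∨ z = 1 := by decide
  obtain ⟨ε, w, hw⟩ := (isCyc_orCyc (T := T)).exists_dual
  have hwc := hw.isCocyc
  have p1' : ∀ lam Z ζ, T.Dual lam Z ζ → T.pr ζ T.orCyc = T.pr ζ Z :=
    fun lam Z ζ h => h.pr_orCyc.symm
  have p1 : ∀ lam Z ζ, T.Dual lam Z ζ → T.pr w Z = T.pr ζ Z :=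
    fun lam Z ζ h => (hw.pr_comm h).trans (p1' _ _ _ h)
  have p2 : T.pr w T.orCyc = 0 := by
    by_contra hne
    have h1 := (hX _).resolve_left hne
    obtain ⟨ζ₀, hζ₀, hind⟩ := exists_cocyc_indep hχ w
    set c := T.pr ζ₀ T.orCyc with hc
    let ζ : Finset ℕ → ZMod 2 := ζ₀ + fun e => c * w e
    have hζ : T.IsCocyc ζ := hζ₀.add (hwc.const_mul c)
    have hζD : T.pr ζ T.orCyc = 0 := by
      rw [pr_add_left, ← hc]
      have : T.pr (fun e => c * w e) T.orCyc = c * T.pr w T.orCyc := by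
        simp only [pr, Finset.mul_sum, mul_assoc]
      rw [this, h1, mul_one, zmod_add_self]
    obtain ⟨lam, Z, hd⟩ := hζ.exists_dual
    have hwZ : T.pr w Z = 0 := (hw.pr_comm hd).trans hζD
    have hζZ : T.pr ζ Z = 0 := (p1 _ _ _ hd).symm.trans hwZ
    have hkill : ∀ η, T.IsCocyc η → T.pr η Z = 0 := by
      intro η hη
      obtain ⟨U, c1, c2, h⟩ := cocyc_span hχ hwc hζ (fun U hU => by
          have := isCyc_orCyc.pr_cob (T := T) U
          rw [← pr_congr_left hU, h1] at this
          exact one_ne_zero this) (fun U d hU => by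
          apply hind U (c + d)
          intro e he
          have h2 := hU e he
          simp only [ζ, Pi.add_apply] at h2
          grind) hη
      rw [pr_eq_of_eq₂ hd.isCyc h, hwZ, hζZ]; ring
    obtain ⟨U, hU⟩ := exists_cob (T := T) (ζ := ζ) (fun Y hY => by
      obtain ⟨mu, η, hdY⟩ := hY.exists_dual
      rw [hd.pr_comm hdY]
      exact hkill η hdY.isCocyc)
    apply hind U c
    intro e he
    have h2 := hU e he
    simp only [ζ, Pi.add_apply] at h2
    grind
  refine ⟨w, hwc, p1, p2, p1', ?_, ?_⟩
  · by_contra! hno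
    obtain ⟨X, hX'⟩ := exists_bd (T := T) (Z := T.orCyc) (fun ζ hζ => by
      obtain ⟨lam, Z, hd⟩ := hζ.exists_dual
      rw [p1' _ _ _ hd, ← p1 _ _ _ hd]
      exact (hX _).resolve_right (hno Z hd.isCyc))
    exact hT.2 (orientable_of_orCyc_eq_bd hX')
  · intro lam A α hd hA Z hZ h1 h2 ζ hζ
    obtain ⟨U, c1, c2, h⟩ := cocyc_span hχ hd.isCocyc hwc (fun U hU => by
        have := hd.isCyc.pr_cob U
        rw [← pr_congr_left hU, hA] at this
        exact one_ne_zero this) (fun U d hU => by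
        have h3 := pr_eq_of_eq hd.isCyc hU
        have h4 := pr_eq_of_eq (isCyc_orCyc (T := T)) hU
        rw [p1 _ _ _ hd, hA, mul_one] at h3
        rw [p2, p1' _ _ _ hd, hA, ← h3] at h4
        exact zero_ne_one (h4.trans (mul_one 1))) hζ
    rw [pr_eq_of_eq₂ hZ h, h1, h2]; ring

theorem mem_vertsOf {F : Finset (Finset ℕ)} {v : ℕ} : v ∈ vertsOf F ↔ ∃ f ∈ F, v ∈ f := by
  simp [vertsOf, Finset.mem_sup]

theorem mem_edgesOf {F : Finset (Finset ℕ)} {e : Finset ℕ} :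
    e ∈ edgesOf F ↔ e.card = 2 ∧ ∃ f ∈ F, e ⊆ f := by
  unfold edgesOf vertsOf
  rw [Finset.mem_filter, Finset.mem_powersetCard]
  constructor
  · rintro ⟨⟨-, h⟩, h'⟩
    exact ⟨h, h'⟩
  · rintro ⟨h, f, hf, hef⟩
    exact ⟨⟨hef.trans (Finset.le_sup (f := id) hf), h⟩, f, hf, hef⟩

theorem isCyc_bd (x : Finset ℕ → ZMod 2) : T.IsCyc (T.bd x) := by
  intro v
  have h : T.pr (cob fun u => if u = v then 1 else 0) (T.bd x) = 0 :=
    (isCocyc_cob _).pr_bd x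
  rw [← h, pr, Finset.sum_filter]
  refine Finset.sum_congr rfl fun e _ => ?_
  simp [cob]

/-- The vertex number `i` of a cyclic list, indices being read modulo its length. -/
def cyc (c : List ℕ) (i : ℕ) : ℕ := c.getD (i % c.length) 0

theorem cyc_inj {c : List ℕ} (hc : c.Nodup) (h0 : 0 < c.length) {i j : ℕ} :
    cyc c i = cyc c j ↔ i % c.length = j % c.length := by
  unfold cyc
  have hi := Nat.mod_lt i h0
  have hj := Nat.mod_lt j h0
  rw [List.getD_eq_getElem _ _ hi, List.getD_eq_getElem _ _ hj]
  exact hc.getElem_inj_iff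

theorem mem_cycEdges {c : List ℕ} (h0 : 0 < c.length) {e : Finset ℕ} :
    e ∈ cycEdges c ↔ ∃ i, e = {cyc c i, cyc c (i + 1)} := by
  unfold cycEdges cyc
  rw [Finset.mem_image]
  constructor
  · rintro ⟨i, hi, rfl⟩
    exact ⟨i, by rw [Nat.mod_eq_of_lt (Finset.mem_range.1 hi)]⟩
  · rintro ⟨i, rfl⟩
    refine ⟨i % c.length, Finset.mem_range.2 (Nat.mod_lt i h0), ?_⟩
    rw [Nat.mod_add_mod]

theorem cyc_mem {c : List ℕ} (h0 : 0 < c.length) (i : ℕ) : cyc c i ∈ c := by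
  unfold cyc
  rw [List.getD_eq_getElem _ _ (Nat.mod_lt i h0)]
  exact List.getElem_mem _

theorem exists_cyc {c : List ℕ} {v : ℕ} (hv : v ∈ c) : ∃ i < c.length, v = cyc c i := by
  obtain ⟨i, hi, rfl⟩ := List.mem_iff_getElem.1 hv
  refine ⟨i, hi, ?_⟩
  unfold cyc
  rw [Nat.mod_eq_of_lt hi, List.getD_eq_getElem _ _ hi]

theorem mem_of_mem_cycEdges {c : List ℕ} (h0 : 0 < c.length) {e : Finset ℕ}
    (he : e ∈ cycEdges c) {v : ℕ} (hv : v ∈ e) : v ∈ c := by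
  obtain ⟨i, rfl⟩ := (mem_cycEdges h0).1 he
  simp only [Finset.mem_insert, Finset.mem_singleton] at hv
  rcases hv with rfl | rfl <;> exact cyc_mem h0 _

theorem mod_add_cases {n i j k : ℕ} (h : (i + k) % n = (j + k) % n) : i % n = j % n :=
  Nat.ModEq.add_right_cancel' k h

theorem not_mod_eq_add {n i d : ℕ} (hd : 0 < d) (hdn : d < n) : i % n ≠ (i + d) % n := by
  intro h
  have h1 : (0 + i) % n = (d + i) % n := by rw [zero_add, add_comm d, h]
  have := mod_add_cases h1
  rw [Nat.zero_mod, Nat.mod_eq_of_lt hdn] at this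
  omega

theorem edge_congr {c : List ℕ} {i j : ℕ} (h : i % c.length = j % c.length) :
    ({cyc c i, cyc c (i + 1)} : Finset ℕ) = {cyc c j, cyc c (j + 1)} := by
  unfold cyc
  rw [h, Nat.add_mod, h, ← Nat.add_mod]

theorem edge_ne_succ {c : List ℕ} (hc : c.Nodup) (h3 : 3 ≤ c.length) (i : ℕ) :
    ({cyc c i, cyc c (i + 1)} : Finset ℕ) ≠ {cyc c (i + 1), cyc c (i + 1 + 1)} := by
  intro h
  have h1 : cyc c i ∈ ({cyc c (i + 1), cyc c (i + 1 + 1)} : Finset ℕ) := by rw [← h]; simp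
  simp only [Finset.mem_insert, Finset.mem_singleton, cyc_inj hc (by omega : 0 < c.length)] at h1
  rcases h1 with h1 | h1
  · exact not_mod_eq_add (by omega) (by omega) h1
  · rw [add_assoc] at h1
    exact not_mod_eq_add (by omega) (by omega) h1

theorem sum_at_cyc {M : Type*} [AddCommMonoid M] {c : List ℕ} (hc : T.IsCycle c)
    {Y : Finset ℕ → M} (hY : ∀ e ∈ T.edges, e ∉ cycEdges c → Y e = 0) (i : ℕ) :
    ∑ e ∈ T.edges with cyc c (i + 1) ∈ e, Y e =
      Y {cyc c i, cyc c (i + 1)} + Y {cyc c (i + 1), cyc c (i + 1 + 1)} := by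
  obtain ⟨h3, hnd, hE⟩ := hc
  have h0 : 0 < c.length := by omega
  rw [← Finset.sum_pair (edge_ne_succ hnd h3 i)]
  symm
  apply Finset.sum_subset
  · intro e he
    simp only [Finset.mem_insert, Finset.mem_singleton] at he
    rw [Finset.mem_filter]
    rcases he with rfl | rfl
    · exact ⟨hE _ ((mem_cycEdges h0).2 ⟨_, rfl⟩), by simp⟩
    · exact ⟨hE _ ((mem_cycEdges h0).2 ⟨_, rfl⟩), by simp⟩
  · intro e he hne
    rw [Finset.mem_filter] at he
    apply hY e he.1
    intro hec
    apply hne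
    obtain ⟨j, rfl⟩ := (mem_cycEdges h0).1 hec
    have := he.2
    simp only [Finset.mem_insert, Finset.mem_singleton, cyc_inj hnd h0] at this ⊢
    rcases this with h | h
    · exact Or.inr (edge_congr h.symm)
    · exact Or.inl (edge_congr (mod_add_cases h).symm)

/-- A cycle supported on a simple cycle is constant on it. -/
theorem IsCyc.const_of_supp {c : List ℕ} (hc : T.IsCycle c) {Y : Finset ℕ → ZMod 2}
    (hYc : T.IsCyc Y) (hY : ∀ e ∈ T.edges, e ∉ cycEdges c → Y e = 0) :
    ∀ e ∈ cycEdges c, ∀ e' ∈ cycEdges c, Y e = Y e' := by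
  have h0 : 0 < c.length := by have := hc.1; omega
  have h : ∀ i, Y {cyc c i, cyc c (i + 1)} = Y {cyc c 0, cyc c (0 + 1)} := by
    intro i
    induction i with
    | zero => rfl
    | succ i ih =>
      have := hYc (cyc c (i + 1))
      rw [sum_at_cyc hc hY i] at this
      grind
  intro e he e' he'
  obtain ⟨i, rfl⟩ := (mem_cycEdges h0).1 he
  obtain ⟨j, rfl⟩ := (mem_cycEdges h0).1 he'
  rw [h i, h j]

theorem isCyc_indicator {c : List ℕ} (hc : T.IsCycle c) :
    T.IsCyc fun e => if e ∈ cycEdges c then 1 else 0 := by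
  intro v
  have h0 : 0 < c.length := by have := hc.1; omega
  by_cases hv : v ∈ c
  · obtain ⟨i, -, rfl⟩ := exists_cyc hv
    have : cyc c i = cyc c (i + c.length - 1 + 1) := by
      rw [cyc_inj hc.2.1 h0, show i + c.length - 1 + 1 = i + c.length by omega, Nat.add_mod_right]
    rw [this, sum_at_cyc hc fun e _ he => if_neg he, if_pos ((mem_cycEdges h0).2 ⟨_, rfl⟩),
      if_pos ((mem_cycEdges h0).2 ⟨_, rfl⟩)]
    rfl
  · refine Finset.sum_eq_zero fun e he => if_neg fun hec => hv ?_
    exact mem_of_mem_cycEdges h0 hec (Finset.mem_filter.1 he).2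

theorem card_cycEdges {c : List ℕ} (hc : T.IsCycle c) : (cycEdges c).card = c.length := by
  obtain ⟨h3, hnd, hE⟩ := hc
  have h0 : 0 < c.length := by omega
  unfold cycEdges
  rw [Finset.card_image_of_injOn, Finset.card_range]
  intro i hi j hj h
  simp only [Finset.coe_range, Set.mem_Iio] at hi hj
  have hh : ∀ i, i < c.length → ({c.getD i 0, c.getD ((i + 1) % c.length) 0} : Finset ℕ) =
      {cyc c i, cyc c (i + 1)} := by
    intro i hi; unfold cyc; rw [Nat.mod_eq_of_lt hi]
  simp only [hh i hi, hh j hj] at h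
  have h1 : cyc c i ∈ ({cyc c j, cyc c (j + 1)} : Finset ℕ) := by rw [← h]; simp
  have h2 : cyc c (i + 1) ∈ ({cyc c j, cyc c (j + 1)} : Finset ℕ) := by rw [← h]; simp
  simp only [Finset.mem_insert, Finset.mem_singleton, cyc_inj hnd h0] at h1 h2
  rw [← Nat.mod_eq_of_lt hi, ← Nat.mod_eq_of_lt hj]
  rcases h1 with h1 | h1
  · exact h1
  · rcases h2 with h2 | h2
    · exfalso
      have h4 : (i + 2) % c.length = (j + 1) % c.length := by
        have := (Nat.ModEq.add_right 1 h2 : _ % _ = _ % _); exact this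
      exact not_mod_eq_add (by omega) (by omega) (h1.trans h4.symm)
    · exact mod_add_cases h2

theorem not_mem_of_bd {X : Finset ℕ → ZMod 2} {c : List ℕ}
    (hX : ∀ e ∈ T.edges, T.bd X e = if e ∈ cycEdges c then 1 else 0) {e f g : Finset ℕ}
    (he : e.card = 2) (hf : f ∈ T.faces) (hg : g ∈ T.faces) (hfg : f ≠ g) (hef : e ⊆ f)
    (heg : e ⊆ g) : e ∉ cycEdges c ↔ X f = X g := by
  have h := hX e (mem_edges.2 ⟨he, f, hf, hef⟩)
  rw [bd_pair he hf hg hfg hef heg] at h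
  have hX : ∀ x y z : ZMod 2, z = 1 → x + y = z → x ≠ y := by decide
  have hX' : ∀ x y : ZMod 2, x + y = 0 → x = y := by decide
  split_ifs at h with hec
  · simp only [hec, not_true, false_iff]; exact hX _ _ _ rfl h
  · simp only [hec, not_false_iff, true_iff]; exact hX' _ _ h

theorem SameSide.eq {X : Finset ℕ → ZMod 2} {c : List ℕ}
    (hX : ∀ e ∈ T.edges, T.bd X e = if e ∈ cycEdges c then 1 else 0) {f g : Finset ℕ}
    (h : T.SameSide c f g) : X f = X g := by
  induction h with
  | refl => rfl
  | tail _ h ih =>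
    obtain ⟨hb, hc, h2, hnc⟩ := h
    rw [ih]
    exact (not_mem_of_bd hX h2 hb hc (ne_of_card_inter hb h2) Finset.inter_subset_left
      Finset.inter_subset_right).1 hnc

theorem sameSide_iff {X : Finset ℕ → ZMod 2} {c : List ℕ} (hc : T.IsCycle c)
    (hX : ∀ e ∈ T.edges, T.bd X e = if e ∈ cycEdges c then 1 else 0)
    (hs : ∀ s, ∃ f ∈ T.faces, X f = s) {f : Finset ℕ} (hf : f ∈ T.faces) {g : Finset ℕ}
    (hg : g ∈ T.faces) : T.SameSide c f g ↔ X f = X g := by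
  refine ⟨fun h => h.eq hX, fun hfg => ?_⟩
  let σ : Finset ℕ → ZMod 2 := fun g => if T.SameSide c f g then 1 else 0
  have hσ : ∀ g ∈ T.faces, ∀ h ∈ T.faces, (g ∩ h).card = 2 → g ∩ h ∉ cycEdges c → σ g = σ h := by
    intro g hg h hh h2 hn
    have : T.SameSide c f g ↔ T.SameSide c f h := by
      constructor
      · exact fun h' => h'.tail ⟨hg, hh, h2, hn⟩
      · rw [Finset.inter_comm] at h2 hn
        exact fun h' => h'.tail ⟨hh, hg, h2, hn⟩
    simp only [σ, this]
  have hY : ∀ e ∈ T.edges, e ∉ cycEdges c → T.bd σ e = 0 := by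
    intro e he hec
    obtain ⟨g, h, hg, hh, hgh, heg, heh⟩ := exists_faces_of_edge he
    have h2 := (mem_edges.1 he).1
    have h3 := inter_eq_of_subset h2 hg hh hgh heg heh
    rw [bd_pair h2 hg hh hgh heg heh, hσ g hg h hh (h3 ▸ h2) (h3 ▸ hec), zmod_add_self]
  have hconst := (isCyc_bd σ).const_of_supp hc hY
  have hff : σ f = 1 := if_pos Relation.ReflTransGen.refl
  have h0 : 0 < c.length := by have := hc.1; omega
  have hX2 : ∀ z : ZMod 2, z = 0 ∨ z = 1 := by decide
  have hz : ∀ x y : ZMod 2, x + y = 0 → x = y := by decide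
  have he0 : ({cyc c 0, cyc c (0 + 1)} : Finset ℕ) ∈ cycEdges c := (mem_cycEdges h0).2 ⟨0, rfl⟩
  have hone : ∀ k, σ k = 1 → T.SameSide c f k := by
    intro k hk; by_contra hn; simp [σ, hn] at hk
  rcases hX2 (T.bd σ {cyc c 0, cyc c (0 + 1)}) with h | h
  · exfalso
    have hall : ∀ g ∈ T.faces, σ f = σ g := by
      intro g hg
      refine eq_on_faces (T := T) (φ := σ) ?_ hf hg
      intro g hg h' hh hgh he
      apply hz
      rw [← bd_pair (mem_edges.1 he).1 hg hh hgh Finset.inter_subset_left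
        Finset.inter_subset_right]
      by_cases hec : g ∩ h' ∈ cycEdges c
      · rw [hconst _ hec _ he0, h]
      · exact hY _ he hec
    obtain ⟨g, hg, hgs⟩ := hs (X f + 1)
    have := (hone g ((hall g hg).symm.trans hff)).eq hX
    rw [hgs] at this
    simp at this
  · apply hone
    have : σ f + X f = σ g + X g := by
      refine eq_on_faces (T := T) (φ := fun k => σ k + X k) ?_ hf hg
      intro g hg h' hh hgh he
      have h2 := (mem_edges.1 he).1
      have h5 := bd_pair (x := σ) h2 hg hh hgh Finset.inter_subset_left Finset.inter_subset_right
      have h6 := bd_pair (x := X) h2 hg hh hgh Finset.inter_subset_left Finset.inter_subset_right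
      have : T.bd σ (g ∩ h') = T.bd X (g ∩ h') := by
        rw [hX _ he]
        split_ifs with hec
        · rw [hconst _ hec _ he0, h]
        · exact hY _ he hec
      rw [h5, h6] at this
      grind
    grind

theorem isNSC_of_cocycles {X : Finset ℕ → ZMod 2} {c : List ℕ} (hc : T.IsCycle c)
    (hX : ∀ e ∈ T.edges, T.bd X e = if e ∈ cycEdges c then 1 else 0)
    (hs : ∀ s, ∃ ζ, T.IsCocyc ζ ∧ (∃ Z, T.IsCyc Z ∧ T.pr ζ Z ≠ 0) ∧
      ∀ e ∈ T.edges, ζ e ≠ 0 → ∀ f ∈ T.faces, e ⊆ f → X f = s) : T.IsNSC c := by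
  have hne : ∀ s, ∃ f ∈ T.faces, X f = s := by
    intro s
    obtain ⟨ζ, -, ⟨Z, -, hZ⟩, h⟩ := hs s
    obtain ⟨e, he, hne⟩ := Finset.exists_ne_zero_of_sum_ne_zero hZ
    obtain ⟨f, hf, hef⟩ := (mem_edges.1 he).2
    exact ⟨f, hf, h e he (left_ne_zero_of_mul hne) f hf hef⟩
  refine ⟨hc, ?_, ?_⟩
  · obtain ⟨f, hf, hf0⟩ := hne 0
    obtain ⟨g, hg, hg0⟩ := hne 1
    refine ⟨f, hf, g, hg, fun h => ?_⟩
    have := h.eq hX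
    rw [hf0, hg0] at this
    exact zero_ne_one this
  intro f hf heul
  obtain ⟨h3, hnd, hE⟩ := id hc
  have h0 : 0 < c.length := by omega
  obtain ⟨ζ, hζ, ⟨Z, hZ, hpr⟩, hsupp⟩ := hs (X f)
  have hmem : ∀ g, g ∈ sideFaces T c f ↔ g ∈ T.faces ∧ X f = X g := by
    intro g
    rw [sideFaces, Finset.mem_filter]
    exact and_congr_right fun hg => sameSide_iff hc hX hne hf hg
  set S := sideFaces T c f with hS
  have hSE : edgesOf S ⊆ T.edges := by
    intro e he
    obtain ⟨h2, g, hg, heg⟩ := mem_edgesOf.1 he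
    exact mem_edges.2 ⟨h2, g, ((hmem g).1 hg).1, heg⟩
  have hcE : cycEdges c ⊆ edgesOf S := by
    intro e he
    obtain ⟨g, h, hg, hh, hgh, heg, heh⟩ := exists_faces_of_edge (hE e he)
    have h2 := (mem_edges.1 (hE e he)).1
    have : X g ≠ X h := fun h' => (not_mem_of_bd hX h2 hg hh hgh heg heh).2 h' he
    refine mem_edgesOf.2 ⟨h2, ?_⟩
    have hz : ∀ x y z : ZMod 2, y ≠ z → x = y ∨ x = z := by decide
    rcases hz (X f) _ _ this with h' | h'
    · exact ⟨g, (hmem g).2 ⟨hg, h'⟩, heg⟩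
    · exact ⟨h, (hmem h).2 ⟨hh, h'⟩, heh⟩
  have hcV : c.toFinset ⊆ vertsOf S := by
    intro v hv
    obtain ⟨i, -, rfl⟩ := exists_cyc (List.mem_toFinset.1 hv)
    obtain ⟨-, g, hg, heg⟩ := mem_edgesOf.1 (hcE ((mem_cycEdges h0).2 ⟨i, rfl⟩))
    exact mem_vertsOf.2 ⟨g, hg, heg (by simp)⟩
  have hzero : ∀ e ∈ cycEdges c, ζ e = 0 := by
    intro e he
    by_contra hne
    obtain ⟨g, h, hg, hh, hgh, heg, heh⟩ := exists_faces_of_edge (hE e he)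
    have : X g ≠ X h := fun h' =>
      (not_mem_of_bd hX (mem_edges.1 (hE e he)).1 hg hh hgh heg heh).2 h' he
    exact this ((hsupp e (hE e he) hne g hg heg).trans (hsupp e (hE e he) hne h hh heh).symm)
  have hsum : ∀ g ∈ S, ∀ φ : Finset ℕ → ZMod 2, (∀ e ∈ cycEdges c, φ e = 0) →
      ∑ e ∈ edgesOf S \ cycEdges c, φ e * (if e ⊆ g then 1 else 0) =
      ∑ e ∈ T.edges, φ e * (if e ⊆ g then 1 else 0) := by
    intro g hg φ hφ
    apply Finset.sum_subset (Finset.sdiff_subset.trans hSE)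
    intro e he hne
    split_ifs with heg
    · rw [Finset.mem_sdiff, not_and_not_right] at hne
      rw [hφ e (hne (mem_edgesOf.2 ⟨(mem_edges.1 he).1, g, hg, heg⟩)), zero_mul]
    · rw [mul_zero]
  have hUsum : ∀ (x : ℕ → ZMod 2) (e : Finset ℕ),
      ∑ v ∈ vertsOf S \ c.toFinset, x v * (if v ∈ e then 1 else 0) =
      cob (fun v => if v ∈ vertsOf S \ c.toFinset then x v else 0) e := by
    intro x e
    simp only [mul_ite, mul_one, mul_zero, cob]
    rw [← Finset.sum_filter, ← Finset.sum_filter, Finset.filter_mem_eq_inter,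
      Finset.filter_mem_eq_inter, Finset.inter_comm]
  have hU0 : ∀ (x : ℕ → ZMod 2), ∀ e ∈ cycEdges c,
      cob (fun v => if v ∈ vertsOf S \ c.toFinset then x v else 0) e = 0 := by
    intro x e he
    refine Finset.sum_eq_zero fun v hv => if_neg fun h => ?_
    rw [Finset.mem_sdiff, List.mem_toFinset] at h
    exact h.2 (mem_of_mem_cycEdges h0 he hv)
  have hz : ∀ x y : ZMod 2, x + y = 0 → x = y := by decide
  obtain ⟨x, hx⟩ := exists_of_euler_one (I := vertsOf S \ c.toFinset)
    (J := edgesOf S \ cycEdges c) (K := S) (M := fun v e => if v ∈ e then 1 else 0)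
    (N := fun f e => if e ⊆ f then 1 else 0) (ζ := ζ) (by
      intro v hv g hg
      rw [hsum g hg (fun e => if v ∈ e then 1 else 0), sum_incidence ((hmem g).1 hg).1]
      intro e he
      rw [Finset.mem_sdiff, List.mem_toFinset] at hv
      exact if_neg fun h => hv.2 (mem_of_mem_cycEdges h0 he h)) (by
      intro x hx v hv
      let U : ℕ → ZMod 2 := fun v => if v ∈ vertsOf S \ c.toFinset then x v else 0
      have hU : ∀ e ∈ edgesOf S, cob U e = 0 := by
        intro e he
        by_cases hec : e ∈ cycEdges c
        · exact hU0 x e hec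
        · rw [← hUsum]; exact hx e (Finset.mem_sdiff.2 ⟨he, hec⟩)
      have hface : ∀ g ∈ S, ∀ u ∈ g, ∀ v ∈ g, U u = U v := by
        intro g hg u hu v hv
        by_cases huv : u = v
        · rw [huv]
        · apply hz
          rw [← cob_pair U huv]
          exact hU _ (mem_edgesOf.2 ⟨Finset.card_pair huv, g, hg, pair_subset.2 ⟨hu, hv⟩⟩)
      have hconn : ∀ g ∈ S, ∀ u ∈ f, ∀ v ∈ g, U u = U v := by
        intro g hg
        have hss : T.SameSide c f g := (Finset.mem_filter.1 hg).2
        clear hg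
        induction hss with
        | refl => exact hface f ((hmem f).2 ⟨hf, rfl⟩)
        | tail hab h ih =>
          rename_i b d
          have hfd : T.SameSide c f d := Relation.ReflTransGen.tail hab h
          obtain ⟨hb, hd, h2, hnc⟩ := h
          intro u hu v hv
          obtain ⟨y, hy⟩ := Finset.card_pos.1 (by omega : 0 < (b ∩ d).card)
          rw [Finset.mem_inter] at hy
          rw [ih u hu y hy.1]
          exact hface d (Finset.mem_filter.2 ⟨hd, hfd⟩) y hy.2 v hv
      obtain ⟨g, hg, hvg⟩ := mem_vertsOf.1 (Finset.mem_sdiff.1 hv).1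
      obtain ⟨g', hg', hvg'⟩ := mem_vertsOf.1 (hcV (List.mem_toFinset.2 (cyc_mem h0 0)))
      obtain ⟨a, b, d, -, -, hfe⟩ := exists_lt_lt hf
      have haf : a ∈ f := by rw [hfe]; simp
      have h1 := hconn g hg a haf v hvg
      rw [hconn g' hg' a haf _ hvg'] at h1
      have h2 : U (cyc c 0) = 0 := if_neg fun h => (Finset.mem_sdiff.1 h).2
        (List.mem_toFinset.2 (cyc_mem h0 0))
      have h3 : U v = x v := if_pos hv
      rw [← h3, ← h1, h2]) (by
      intro z hzz
      have hconn : ∀ g ∈ S, z f = z g := by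
        intro g hg
        have hss : T.SameSide c f g := (Finset.mem_filter.1 hg).2
        clear hg
        induction hss with
        | refl => rfl
        | tail hab h ih =>
          rename_i b d
          have hfd : T.SameSide c f d := Relation.ReflTransGen.tail hab h
          obtain ⟨hb, hd, h2, hnc⟩ := h
          have hbS : b ∈ S := Finset.mem_filter.2 ⟨hb, hab⟩
          have hdS : d ∈ S := Finset.mem_filter.2 ⟨hd, hfd⟩
          rw [ih]
          apply hz
          have := hzz (b ∩ d) (Finset.mem_sdiff.2
            ⟨mem_edgesOf.2 ⟨h2, b, hbS, Finset.inter_subset_left⟩, hnc⟩)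
          simp only [mul_ite, mul_one, mul_zero] at this
          rw [← Finset.sum_filter] at this
          have hfil : S.filter (fun g => b ∩ d ⊆ g) = {b, d} := by
            have h5 := faces_of_edge h2 hb hd (ne_of_card_inter hb h2) Finset.inter_subset_left
              Finset.inter_subset_right
            ext k
            rw [← h5, Finset.mem_filter, Finset.mem_filter]
            constructor
            · rintro ⟨h6, h7⟩
              exact ⟨((hmem k).1 h6).1, h7⟩
            · intro h6
              rw [← Finset.mem_filter, h5] at h6
              refine ⟨?_, ?_⟩
              · simp only [Finset.mem_insert, Finset.mem_singleton] at h6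
                rcases h6 with rfl | rfl <;> assumption
              · rw [← h5] at h6; exact (Finset.mem_filter.1 h6).2
          rwa [hfil, Finset.sum_pair (ne_of_card_inter hb h2)] at this
      intro k hk k' hk'
      rw [← hconn k hk, hconn k' hk']) (by
      rw [Finset.card_sdiff_of_subset hcV, Finset.card_sdiff_of_subset hcE, card_cycEdges hc,
        List.toFinset_card_of_nodup hnd]
      have h1 := Finset.card_le_card hcV
      have h2 := Finset.card_le_card hcE
      rw [card_cycEdges hc] at h2
      rw [List.toFinset_card_of_nodup hnd] at h1
      rw [sideEuler, ← hS] at heul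
      omega) (by
      intro g hg
      rw [hsum g hg ζ hzero]
      have := hζ g ((hmem g).1 hg).1
      rw [Finset.sum_filter] at this
      simpa using this)
  apply hpr
  rw [pr_congr_left (ζ' := cob fun v => if v ∈ vertsOf S \ c.toFinset then x v else 0)]
  · exact hZ.pr_cob _
  intro e he
  by_cases heS : e ∈ edgesOf S
  · by_cases hec : e ∈ cycEdges c
    · rw [hzero e hec, hU0 x e hec]
    · rw [hx e (Finset.mem_sdiff.2 ⟨heS, hec⟩), hUsum]
  · obtain ⟨g, hg, heg⟩ := (mem_edges.1 he).2
    have hgX : X f ≠ X g := fun h =>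
      heS (mem_edgesOf.2 ⟨(mem_edges.1 he).1, g, (hmem g).2 ⟨hg, h⟩, heg⟩)
    rw [cob, Finset.sum_eq_zero]
    · by_contra hne
      exact hgX (hsupp e he hne g hg heg).symm
    · intro v hv
      refine if_neg fun h => hgX ?_
      rw [Finset.mem_sdiff, List.mem_toFinset] at h
      obtain ⟨k, hk, hvk⟩ := mem_vertsOf.1 h.1
      rw [((hmem k).1 hk).2]
      refine eq_on_star (φ := X) (v := v) ?_ ((hmem k).1 hk).1 hg hvk (heg hv)
      intro u huv f hf g hg hfg h1 h2
      refine (not_mem_of_bd hX (Finset.card_pair huv.symm) hf hg hfg h1 h2).1 fun h' => h.2 ?_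
      exact mem_of_mem_cycEdges h0 h' (by simp)

theorem zmod_eq_one {x : ZMod 2} (h : x ≠ 0) : x = 1 := by
  revert x; decide

theorem exists_pair_mem {e : Finset ℕ} (he : e ∈ T.edges) {v : ℕ} (hv : v ∈ e) :
    ∃ u, u ≠ v ∧ e = {v, u} := by
  obtain ⟨a, b, hab, rfl⟩ := Finset.card_eq_two.1 (mem_edges.1 he).1
  simp only [Finset.mem_insert, Finset.mem_singleton] at hv
  rcases hv with rfl | rfl
  · exact ⟨b, hab.symm, rfl⟩
  · exact ⟨a, hab, Finset.pair_comm _ _⟩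

/-- A closed path inside a path with an edge back to its starting vertex. -/
theorem isCycle_take {Y : Finset ℕ → ZMod 2} {u : ℕ} {l : List ℕ} {k : ℕ} (hk : 2 ≤ k)
    (hkl : k < (u :: l).length) (hnd : (u :: l).Nodup)
    (hch : (u :: l).IsChain fun a b => {a, b} ∈ T.edges ∧ Y {a, b} ≠ 0)
    (h : {u, (u :: l)[k]} ∈ T.edges ∧ Y {u, (u :: l)[k]} ≠ 0) :
    ∃ c, T.IsCycle c ∧ ∀ e ∈ cycEdges c, Y e ≠ 0 := by
  set L := u :: l with hL
  have hlen : (L.take (k + 1)).length = k + 1 := by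
    rw [List.length_take]; omega
  have key : ∀ e ∈ cycEdges (L.take (k + 1)), e ∈ T.edges ∧ Y e ≠ 0 := by
    intro e he
    unfold cycEdges at he
    rw [hlen] at he
    obtain ⟨i, hi, rfl⟩ := Finset.mem_image.1 he
    rw [Finset.mem_range] at hi
    rcases Nat.lt_or_ge i k with hik | hik
    · rw [Nat.mod_eq_of_lt (by omega), List.getD_eq_getElem _ _ (by omega),
        List.getD_eq_getElem _ _ (by omega), List.getElem_take, List.getElem_take]
      exact List.isChain_iff_getElem.1 hch i (by omega)
    · obtain rfl : i = k := by omega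
      rw [Nat.mod_self, List.getD_eq_getElem _ _ (by omega),
        List.getD_eq_getElem _ _ (by omega), List.getElem_take, List.getElem_take,
        Finset.pair_comm]
      exact h
  exact ⟨L.take (k + 1), ⟨by omega, hnd.sublist (List.take_sublist _ _),
    fun e he => (key e he).1⟩, fun e he => (key e he).2⟩

/-- The support of a nonzero cycle contains a simple closed path. -/
theorem IsCyc.exists_isCycle {Y : Finset ℕ → ZMod 2} (hY : T.IsCyc Y) {e : Finset ℕ}
    (he : e ∈ T.edges) (h : Y e ≠ 0) : ∃ c, T.IsCycle c ∧ ∀ e ∈ cycEdges c, Y e ≠ 0 := by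
  by_contra hno
  have step : ∀ n, ∃ u v l, (u :: v :: l).Nodup ∧
      (u :: v :: l).IsChain (fun a b => {a, b} ∈ T.edges ∧ Y {a, b} ≠ 0) ∧
      (∀ x ∈ u :: v :: l, x ∈ T.verts) ∧ l.length = n := by
    intro n
    induction n with
    | zero =>
      obtain ⟨a, b, hab, rfl⟩ := Finset.card_eq_two.1 (mem_edges.1 he).1
      have := subset_verts he
      refine ⟨a, b, [], by simp [hab], by simp [he, h], ?_, rfl⟩
      intro x hx
      apply this
      simpa using hx
    | succ n ih =>
      obtain ⟨u, v, l, hnd, hch, hV, hl⟩ := ih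
      have huv := (List.isChain_cons_cons.1 hch).1
      have hsum := hY u
      have hmem : ({u, v} : Finset ℕ) ∈ T.edges.filter (u ∈ ·) :=
        Finset.mem_filter.2 ⟨huv.1, by simp⟩
      rw [← Finset.add_sum_erase _ _ hmem] at hsum
      obtain ⟨d, hd, hd0⟩ := Finset.exists_ne_zero_of_sum_ne_zero
        (fun h => huv.2 (by rwa [h, add_zero] at hsum))
      rw [Finset.mem_erase, Finset.mem_filter] at hd
      obtain ⟨w, hwu, rfl⟩ := exists_pair_mem hd.2.1 hd.2.2
      have hwv : w ≠ v := by rintro rfl; exact hd.1 rfl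
      have hwl : w ∉ u :: v :: l := by
        intro hw
        obtain ⟨k, hk, rfl⟩ := List.mem_iff_getElem.1 hw
        have hk2 : 2 ≤ k := by
          rcases k with _ | _ | k
          · exact absurd rfl hwu
          · exact absurd rfl hwv
          · omega
        exact hno (isCycle_take hk2 hk hnd hch ⟨hd.2.1, hd0⟩)
      refine ⟨w, u, v :: l, List.nodup_cons.2 ⟨hwl, hnd⟩, ?_, ?_, by simp [hl]⟩
      · refine List.isChain_cons_cons.2 ⟨?_, hch⟩
        rw [Finset.pair_comm]
        exact ⟨hd.2.1, hd0⟩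
      · intro x hx
        rcases List.mem_cons.1 hx with rfl | hx
        · exact subset_verts hd.2.1 (by simp)
        · exact hV x hx
  obtain ⟨u, v, l, hnd, -, hV, hl⟩ := step T.verts.card
  have h1 : (u :: v :: l).toFinset.card ≤ T.verts.card :=
    Finset.card_le_card fun x hx => hV x (List.mem_toFinset.1 hx)
  rw [List.toFinset_card_of_nodup hnd, List.length_cons, List.length_cons] at h1
  omega

/-- The part of a cocycle lying on one side of a separating curve disjoint from it. -/
theorem IsCocyc.exists_restrict {ζ : Finset ℕ → ZMod 2} (hζ : T.IsCocyc ζ)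
    {X : Finset ℕ → ZMod 2} (h : ∀ e ∈ T.edges, ζ e ≠ 0 → T.bd X e = 0) (s : ZMod 2) :
    ∃ ζ', T.IsCocyc ζ' ∧
      ∀ e ∈ T.edges, ∀ f ∈ T.faces, e ⊆ f → ζ' e = if X f = s then ζ e else 0 := by
  have key : ∀ e ∈ T.edges, ∀ f ∈ T.faces, e ⊆ f →
      (if ∃ g ∈ T.faces, e ⊆ g ∧ X g = s then ζ e else 0) = if X f = s then ζ e else 0 := by
    intro e he f hf hef
    by_cases h0 : ζ e = 0
    · simp [h0]
    · congr 1
      refine propext ⟨?_, fun hs => ⟨f, hf, hef, hs⟩⟩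
      rintro ⟨g, hg, heg, rfl⟩
      by_cases hfg : f = g
      · rw [hfg]
      · have := h e he h0
        rw [bd_pair (mem_edges.1 he).1 hf hg hfg hef heg] at this
        grind
  refine ⟨fun e => if ∃ g ∈ T.faces, e ⊆ g ∧ X g = s then ζ e else 0, ?_, key⟩
  intro f hf
  rw [Finset.sum_congr rfl fun e he =>
    key e (Finset.mem_filter.1 he).1 f hf (Finset.mem_filter.1 he).2]
  split_ifs
  · exact hζ f hf
  · exact Finset.sum_const_zero

/-- Two nontrivial cocycles with supports separated by a face function, such that every cycle
killed by both is killed by all cocycles, yield an NSC. -/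
theorem exists_isNSC_of_separated {X ζ₁ ζ₂ : Finset ℕ → ZMod 2} (h₁ : T.IsCocyc ζ₁)
    (h₂ : T.IsCocyc ζ₂) (hn₁ : ∃ Z, T.IsCyc Z ∧ T.pr ζ₁ Z ≠ 0)
    (hn₂ : ∃ Z, T.IsCyc Z ∧ T.pr ζ₂ Z ≠ 0)
    (hk : ∀ Z, T.IsCyc Z → T.pr ζ₁ Z = 0 → T.pr ζ₂ Z = 0 → ∀ ζ, T.IsCocyc ζ → T.pr ζ Z = 0)
    (hX₁ : ∀ e ∈ T.edges, ζ₁ e ≠ 0 → ∀ f ∈ T.faces, e ⊆ f → X f = 1)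
    (hX₂ : ∀ e ∈ T.edges, ζ₂ e ≠ 0 → ∀ f ∈ T.faces, e ⊆ f → X f = 0) :
    ∃ c, T.IsNSC c := by
  induction hn : (T.edges.filter fun e => T.bd X e ≠ 0).card using Nat.strong_induction_on
    generalizing X ζ₁ ζ₂ with
  | _ n ih =>
  have hexf : ∀ ζ : Finset ℕ → ZMod 2, (∃ Z, T.IsCyc Z ∧ T.pr ζ Z ≠ 0) →
      ∃ e ∈ T.edges, ζ e ≠ 0 ∧ ∃ f ∈ T.faces, e ⊆ f := by
    rintro ζ ⟨Z, -, hZ⟩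
    obtain ⟨e, he, hne⟩ := Finset.exists_ne_zero_of_sum_ne_zero hZ
    exact ⟨e, he, left_ne_zero_of_mul hne, (mem_edges.1 he).2⟩
  obtain ⟨e, he, hXe⟩ : ∃ e ∈ T.edges, T.bd X e ≠ 0 := by
    by_contra! hcon
    obtain ⟨e, he, hne, f, hf, hef⟩ := hexf ζ₁ hn₁
    obtain ⟨e', he', hne', g, hg, heg⟩ := hexf ζ₂ hn₂
    have : X f = X g := by
      refine eq_on_faces (T := T) (φ := X) ?_ hf hg
      intro f hf g hg hfg h
      have h' := hcon _ h
      rw [bd_pair (mem_edges.1 h).1 hf hg hfg Finset.inter_subset_left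
        Finset.inter_subset_right] at h'
      grind
    rw [hX₁ e he hne f hf hef, hX₂ e' he' hne' g hg heg] at this
    exact one_ne_zero this
  obtain ⟨c, hc, hcX⟩ := (isCyc_bd X).exists_isCycle he hXe
  have hoff : ∀ (ζ : Finset ℕ → ZMod 2) (s : ZMod 2),
      (∀ e ∈ T.edges, ζ e ≠ 0 → ∀ f ∈ T.faces, e ⊆ f → X f = s) →
      ∀ e ∈ cycEdges c, ζ e = 0 := by
    intro ζ s h e hec
    by_contra hne
    have he := hc.2.2 e hec
    obtain ⟨f, g, hf, hg, hfg, hef, heg⟩ := exists_faces_of_edge he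
    apply hcX e hec
    rw [bd_pair (mem_edges.1 he).1 hf hg hfg hef heg, h e he hne f hf hef, h e he hne g hg heg,
      zmod_add_self]
  have hpr : ∀ ζ : Finset ℕ → ZMod 2, (∀ e ∈ cycEdges c, ζ e = 0) →
      T.pr ζ (fun e => if e ∈ cycEdges c then 1 else 0) = 0 := by
    intro ζ h
    refine Finset.sum_eq_zero fun e _ => ?_
    by_cases hec : e ∈ cycEdges c
    · rw [h e hec, zero_mul]
    · simp only [if_neg hec, mul_zero]
  obtain ⟨X', hX'⟩ := exists_bd (hk _ (isCyc_indicator hc) (hpr _ (hoff ζ₁ 1 hX₁))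
    (hpr _ (hoff ζ₂ 0 hX₂)))
  have hX'0 : ∀ ζ : Finset ℕ → ZMod 2, (∀ e ∈ cycEdges c, ζ e = 0) →
      ∀ e ∈ T.edges, ζ e ≠ 0 → T.bd X' e = 0 := by
    intro ζ h e he hne
    rw [← hX' e he, if_neg fun hec => hne (h e hec)]
  choose A hA hA' using h₁.exists_restrict (hX'0 _ (hoff ζ₁ 1 hX₁))
  choose B hB hB' using h₂.exists_restrict (hX'0 _ (hoff ζ₂ 0 hX₂))
  have hsupp : ∀ (ζ ζ' : Finset ℕ → ZMod 2) (s : ZMod 2),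
      (∀ e ∈ T.edges, ∀ f ∈ T.faces, e ⊆ f → ζ' e = if X' f = s then ζ e else 0) →
      ∀ e ∈ T.edges, ζ' e ≠ 0 → ∀ f ∈ T.faces, e ⊆ f → X' f = s := by
    intro ζ ζ' s h e he hne f hf hef
    by_contra hs
    rw [h e he f hf hef, if_neg hs] at hne
    exact hne rfl
  have hsum : ∀ (ζ : Finset ℕ → ZMod 2) (ζ' : ZMod 2 → Finset ℕ → ZMod 2),
      (∀ s, ∀ e ∈ T.edges, ∀ f ∈ T.faces, e ⊆ f → ζ' s e = if X' f = s then ζ e else 0) →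
      ∀ (s : ZMod 2) (Z : Finset ℕ → ZMod 2), T.pr ζ Z = T.pr (ζ' s) Z + T.pr (ζ' (s + 1)) Z := by
    intro ζ ζ' h s Z
    rw [← pr_add_left]
    apply pr_congr_left
    intro e he
    obtain ⟨f, hf, hef⟩ := (mem_edges.1 he).2
    rw [Pi.add_apply, h s e he f hf hef, h (s + 1) e he f hf hef]
    have : ∀ x s : ZMod 2, (x = s ∧ x ≠ s + 1) ∨ (x ≠ s ∧ x = s + 1) := by decide
    rcases this (X' f) s with ⟨h1, h2⟩ | ⟨h1, h2⟩
    · rw [if_pos h1, if_neg h2, add_zero]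
    · rw [if_neg h1, if_pos h2, zero_add]
  by_cases hex : ∃ s, (∃ Z, T.IsCyc Z ∧ T.pr (A s) Z ≠ 0) ∧
      ∃ Z, T.IsCyc Z ∧ T.pr (B (s + 1)) Z ≠ 0
  · obtain ⟨s, hAs, hBs⟩ := hex
    refine ⟨c, isNSC_of_cocycles hc (fun e he => (hX' e he).symm) fun t => ?_⟩
    have : ∀ s t : ZMod 2, t = s ∨ t = s + 1 := by decide
    rcases this s t with rfl | rfl
    · exact ⟨A t, hA t, hAs, hsupp _ _ _ (hA' t)⟩
    · exact ⟨B (s + 1), hB _, hBs, hsupp _ _ _ (hB' _)⟩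
  have hs : ∃ s, (∀ Z, T.IsCyc Z → T.pr (A (s + 1)) Z = 0) ∧
      ∀ Z, T.IsCyc Z → T.pr (B (s + 1)) Z = 0 := by
    push Not at hex
    have hone : (1 : ZMod 2) + 1 = 0 := rfl
    by_cases hA0 : ∃ Z, T.IsCyc Z ∧ T.pr (A 0) Z ≠ 0
    · have hB1 := hex 0 hA0
      refine ⟨0, ?_, hB1⟩
      by_contra! hA1
      rw [zero_add] at hA1 hB1
      have hB0 := hex 1 hA1
      rw [hone] at hB0
      obtain ⟨Z, hZ, h⟩ := hn₂
      apply h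
      rw [hsum _ _ hB' 0 Z, hB0 Z hZ, zero_add, zero_add, hB1 Z hZ]
    · push Not at hA0
      refine ⟨1, by rwa [hone], ?_⟩
      apply hex
      obtain ⟨Z, hZ, h⟩ := hn₁
      refine ⟨Z, hZ, ?_⟩
      rwa [hsum _ _ hA' 0 Z, hA0 Z hZ, zero_add, zero_add] at h
  obtain ⟨s, hAs, hBs⟩ := hs
  have hAeq : ∀ Z, T.IsCyc Z → T.pr (A s) Z = T.pr ζ₁ Z := by
    intro Z hZ
    rw [hsum _ _ hA' s Z, hAs Z hZ, add_zero]
  have hBeq : ∀ Z, T.IsCyc Z → T.pr (B s) Z = T.pr ζ₂ Z := by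
    intro Z hZ
    rw [hsum _ _ hB' s Z, hBs Z hZ, add_zero]
  have hside : ∀ (ζ ζ' : Finset ℕ → ZMod 2) (r : ZMod 2),
      (∀ e ∈ T.edges, ζ e ≠ 0 → ∀ f ∈ T.faces, e ⊆ f → X f = r) →
      (∀ e ∈ T.edges, ∀ f ∈ T.faces, e ⊆ f → ζ' e = if X' f = s then ζ e else 0) →
      ∀ e ∈ T.edges, ζ' e ≠ 0 → ∀ f ∈ T.faces, e ⊆ f → X f + (X' f + s) = r := by
    intro ζ ζ' r h h' e he hne f hf hef
    have h1 := hsupp ζ ζ' s h' e he hne f hf hef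
    have h2 := hne
    rw [h' e he f hf hef, if_pos h1] at h2
    rw [h1, zmod_add_self, add_zero]
    exact h e he h2 f hf hef
  refine ih _ ?_ (X := fun f => X f + (X' f + s)) (hA s) (hB s) ?_ ?_ ?_
    (hside _ _ _ hX₁ (hA' s)) (hside _ _ _ hX₂ (hB' s)) rfl
  · rw [← hn]
    apply Finset.card_lt_card
    rw [Finset.ssubset_iff_of_subset]
    · have h0 : 0 < c.length := by have := hc.1; omega
      have he0 : ({cyc c 0, cyc c (0 + 1)} : Finset ℕ) ∈ cycEdges c := (mem_cycEdges h0).2 ⟨0, rfl⟩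
      refine ⟨_, Finset.mem_filter.2 ⟨hc.2.2 _ he0, hcX _ he0⟩, ?_⟩
      intro hm
      apply (Finset.mem_filter.1 hm).2
      have he := hc.2.2 _ he0
      have h1 := hX' _ he
      have h2 := zmod_eq_one (hcX _ he0)
      rw [if_pos he0] at h1
      obtain ⟨f, g, hf, hg, hfg, hef, heg⟩ := exists_faces_of_edge he
      rw [bd_pair (mem_edges.1 he).1 hf hg hfg hef heg] at h1 h2 ⊢
      grind
    · intro e he
      rw [Finset.mem_filter] at he ⊢
      refine ⟨he.1, fun h0 => he.2 ?_⟩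
      have h1 := hX' e he.1
      rw [if_neg fun h => hcX e h h0] at h1
      obtain ⟨f, g, hf, hg, hfg, hef, heg⟩ := exists_faces_of_edge he.1
      rw [bd_pair (mem_edges.1 he.1).1 hf hg hfg hef heg] at h0 h1 ⊢
      grind
  · obtain ⟨Z, hZ, h⟩ := hn₁
    exact ⟨Z, hZ, by rwa [hAeq Z hZ]⟩
  · obtain ⟨Z, hZ, h⟩ := hn₂
    exact ⟨Z, hZ, by rwa [hBeq Z hZ]⟩
  · intro Z hZ h h'
    exact hk Z hZ (by rwa [hAeq Z hZ] at h) (by rwa [hBeq Z hZ] at h')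

theorem IsOrClass.add_cob {w : Finset ℕ → ZMod 2} (h : T.IsOrClass w) (U : ℕ → ZMod 2) :
    T.IsOrClass (w + cob U) := by
  have key : ∀ Z, T.IsCyc Z → T.pr (w + cob U) Z = T.pr w Z := fun Z hZ => by
    rw [pr_add_left, hZ.pr_cob, add_zero]
  obtain ⟨Z, hZ, h1⟩ := h.exists_odd
  exact ⟨h.cocyc.add (isCocyc_cob U),
    fun lam Z ζ hd => (key Z hd.isCyc).trans (h.pr_self lam Z ζ hd),
    (key _ isCyc_orCyc).trans h.pr_orCyc, h.pr_orCyc_right, ⟨Z, hZ, (key Z hZ).trans h1⟩,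
    fun lam A α hd hA Z hZ hα hw => h.killed lam A α hd hA Z hZ hα (by rwa [key Z hZ] at hw)⟩

/-- Walks in the graph of a triangulation, with their length and the sum of `w` along them. -/
inductive Wk (T : Triangulation) (w : Finset ℕ → ZMod 2) : ℕ → ℕ → ℕ → ZMod 2 → Prop
  | nil (u : ℕ) : Wk T w 0 u u 0
  | snoc {n u v x : ℕ} {p : ZMod 2} : Wk T w n u v p → {v, x} ∈ T.edges →
      Wk T w (n + 1) u x (p + w {v, x})

theorem Wk.append {w : Finset ℕ → ZMod 2} {n m u v x : ℕ} {p q : ZMod 2} (h : T.Wk w n u v p)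
    (h' : T.Wk w m v x q) : T.Wk w (n + m) u x (p + q) := by
  induction h' with
  | nil => simpa using h
  | snoc _ he ih =>
    rw [← add_assoc, ← add_assoc]
    exact (ih h).snoc he

theorem Wk.single {w : Finset ℕ → ZMod 2} {u v : ℕ} (h : {u, v} ∈ T.edges) :
    T.Wk w 1 u v (w {u, v}) := by
  simpa using (Wk.nil (T := T) (w := w) u).snoc h

theorem Wk.reverse {w : Finset ℕ → ZMod 2} {n u v : ℕ} {p : ZMod 2} (h : T.Wk w n u v p) :
    T.Wk w n v u p := by
  induction h with
  | nil => exact Wk.nil _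
  | snoc _ he ih =>
    rw [Finset.pair_comm] at he ⊢
    simpa only [add_comm] using (Wk.single he).append ih

theorem Wk.add_cob {w : Finset ℕ → ZMod 2} {n u v : ℕ} {p : ZMod 2} (h : T.Wk w n u v p)
    (U : ℕ → ZMod 2) : T.Wk (w + cob U) n u v (p + U u + U v) := by
  induction h with
  | nil => simpa [zmod_add_self] using Wk.nil _
  | @snoc n u v x p _ he ih =>
    convert ih.snoc he using 1
    rw [Pi.add_apply, cob_pair U (ne_of_pair_mem_edges he)]
    grind

theorem Wk.exists_fun {w : Finset ℕ → ZMod 2} {n u v : ℕ} {p : ZMod 2} (h : T.Wk w n u v p) :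
    ∃ b : ℕ → ℕ, b 0 = u ∧ b n = v ∧ (∀ i < n, {b i, b (i + 1)} ∈ T.edges) ∧
      p = ∑ i ∈ Finset.range n, w {b i, b (i + 1)} := by
  induction h with
  | nil => exact ⟨fun _ => _, rfl, rfl, by simp, by simp⟩
  | @snoc n u v x p _ he ih =>
    obtain ⟨b, h0, hn, hE, hp⟩ := ih
    have hb : ∀ i ≤ n, (if i ≤ n then b i else x) = b i := fun i hi => if_pos hi
    have hx : (if n + 1 ≤ n then b (n + 1) else x) = x := if_neg (by omega)
    refine ⟨fun i => if i ≤ n then b i else x, (hb 0 (by omega)).trans h0, hx, ?_, ?_⟩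
    · intro i hi
      rcases Nat.lt_or_ge i n with hi' | hi'
      · simp only [hb i (by omega), hb (i + 1) (by omega)]
        exact hE i hi'
      · obtain rfl : i = n := by omega
        simp only [le_refl, if_true, hx, hn]
        exact he
    · rw [Finset.sum_range_succ]
      simp only [le_refl, if_true, hx, hn, hp]
      congr 1
      refine Finset.sum_congr rfl fun i hi => ?_
      rw [Finset.mem_range] at hi
      rw [hb i (by omega), hb (i + 1) (by omega)]

theorem IsOrClass.exists_odd_walk {w : Finset ℕ → ZMod 2} (h : T.IsOrClass w) :
    ∃ n u, T.Wk w n u u 1 := by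
  by_contra! hno
  obtain ⟨f, hf⟩ := T.faces_nonempty
  obtain ⟨a, b, c, -, -, rfl⟩ := exists_lt_lt hf
  have hreach : ∀ v ∈ T.verts, ∃ n p, T.Wk w n a v p := by
    intro v hv
    have ha : a ∈ T.verts := mem_verts.2 ⟨_, hf, by simp⟩
    have key : ∀ u v, ({u, v} : Finset ℕ) ∈ T.edges → (∃ n p, T.Wk w n a u p) →
        ∃ n p, T.Wk w n a v p := fun u v he ⟨n, p, h⟩ => ⟨n + 1, _, h.snoc he⟩
    have := eq_on_verts (T := T) (φ := fun v => ∃ n p, T.Wk w n a v p) (fun u v he =>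
      propext ⟨key u v he, key v u (by rwa [Finset.pair_comm])⟩) ha hv
    exact this.mp ⟨0, 0, Wk.nil _⟩
  choose! N U hU using hreach
  obtain ⟨Z, hZ, h1⟩ := h.exists_odd
  have : T.pr w Z = T.pr (cob U) Z := by
    apply pr_congr_left
    intro e he
    obtain ⟨u, v, -, -, -, rfl, -⟩ := exists_pair he
    have hu := hU u (subset_verts he (by simp))
    have hv := hU v (subset_verts he (by simp))
    rw [cob_pair U (ne_of_pair_mem_edges he)]
    by_contra hne
    have := (hu.snoc he).append hv.reverse
    have hz : ∀ x y z : ZMod 2, z ≠ x + y → x + z + y = 1 := by decide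
    rw [hz _ _ _ hne] at this
    exact hno _ _ this
  rw [this, hZ.pr_cob] at h1
  exact zero_ne_one h1

/-- A closed walk, given as a periodic sequence, with odd `w`-sum and of the least possible
length. -/
structure IsShortest (T : Triangulation) (w : Finset ℕ → ZMod 2) (k : ℕ) (a : ℕ → ℕ) : Prop where
  per : ∀ i, a (i + k) = a i
  edge : ∀ i, {a i, a (i + 1)} ∈ T.edges
  odd : ∑ t ∈ Finset.range k, w {a t, a (t + 1)} = 1
  min : ∀ n u, T.Wk w n u u 1 → k ≤ n

theorem IsOrClass.exists_isShortest {w : Finset ℕ → ZMod 2} (h : T.IsOrClass w) :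
    ∃ k a, T.IsShortest w k a := by
  obtain ⟨u, hu⟩ := Nat.find_spec h.exists_odd_walk
  set k := Nat.find h.exists_odd_walk with hk
  obtain ⟨b, h0, hn, hE, hp⟩ := hu.exists_fun
  have hk0 : 0 < k := by
    rcases Nat.eq_zero_or_pos k with h | h
    · rw [h] at hp; simp at hp
    · exact h
  have hsucc : ∀ i, b ((i + 1) % k) = b (i % k + 1) := by
    intro i
    have := Nat.mod_lt i hk0
    rcases Nat.lt_or_ge (i % k + 1) k with h | h
    · rw [← Nat.mod_add_mod, Nat.mod_eq_of_lt h]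
    · have : i % k + 1 = k := by omega
      rw [← Nat.mod_add_mod, this, Nat.mod_self, h0, hn]
  refine ⟨k, fun i => b (i % k), fun i => by rw [Nat.add_mod_right], ?_, ?_, ?_⟩
  · intro i
    simp only [hsucc]
    exact hE _ (Nat.mod_lt i hk0)
  · rw [hp]
    refine Finset.sum_congr rfl fun i hi => ?_
    rw [hsucc, Nat.mod_eq_of_lt (Finset.mem_range.1 hi)]
  · intro n u hu
    exact Nat.find_min' _ ⟨u, hu⟩

theorem sum_cob_path (U : ℕ → ZMod 2) (a : ℕ → ℕ) (n : ℕ) :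
    ∑ t ∈ Finset.range n, (U (a t) + U (a (t + 1))) = U (a 0) + U (a n) := by
  induction n with
  | zero => simp [zmod_add_self]
  | succ n ih => rw [Finset.sum_range_succ, ih]; grind

namespace IsShortest

variable {w : Finset ℕ → ZMod 2} {k : ℕ} {a : ℕ → ℕ}

theorem add_cob (h : T.IsShortest w k a) (U : ℕ → ZMod 2) : T.IsShortest (w + cob U) k a := by
  refine ⟨h.per, h.edge, ?_, fun n u hu => h.min n u ?_⟩
  · simp only [Pi.add_apply, Finset.sum_add_distrib, h.odd,
      cob_pair U (ne_of_pair_mem_edges (h.edge _))]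
    have := h.per 0
    rw [zero_add] at this
    rw [← Finset.sum_add_distrib, sum_cob_path, this, zmod_add_self, add_zero]
  · have := hu.add_cob U
    convert this using 1
    · ext e; simp [add_assoc, zmod_add_self]
    · rw [add_assoc, zmod_add_self, add_zero]

theorem wk (h : T.IsShortest w k a) {i j : ℕ} (hij : i ≤ j) :
    T.Wk w (j - i) (a i) (a j) (∑ t ∈ Finset.Ico i j, w {a t, a (t + 1)}) := by
  induction j, hij using Nat.le_induction with
  | base => simpa using Wk.nil _
  | succ j hij ih =>
    rw [Finset.sum_Ico_succ_top hij, Nat.succ_sub hij]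
    exact ih.snoc (h.edge j)

theorem odd' (h : T.IsShortest w k a) (i : ℕ) :
    ∑ t ∈ Finset.Ico i (i + k), w {a t, a (t + 1)} = 1 := by
  induction i with
  | zero => rw [zero_add, ← Finset.range_eq_Ico, h.odd]
  | succ i ih =>
    rw [← ih]
    rcases Nat.eq_zero_or_pos k with rfl | hk
    · simp
    rw [Finset.sum_eq_sum_Ico_succ_bot (show i < i + k by omega), add_right_comm,
      Finset.sum_Ico_succ_top (show i + 1 ≤ i + k by omega), add_right_comm i k 1, h.per,
      h.per, add_comm]

theorem le_of_eq (h : T.IsShortest w k a) {i j n : ℕ} (hij : i ≤ j) (hjk : j ≤ i + k)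
    (hw : T.Wk w n (a i) (a j) (∑ t ∈ Finset.Ico i j, w {a t, a (t + 1)})) : j - i ≤ n := by
  have h1 := h.wk hjk
  rw [h.per] at h1
  have h2 := hw.append h1
  rw [Finset.sum_Ico_consecutive _ hij hjk, h.odd'] at h2
  have := h.min _ _ h2
  omega

theorem le_of_ne (h : T.IsShortest w k a) {i j n : ℕ} (hij : i ≤ j) {p : ZMod 2}
    (hw : T.Wk w n (a i) (a j) p) (hp : p ≠ ∑ t ∈ Finset.Ico i j, w {a t, a (t + 1)}) :
    k ≤ n + (j - i) := by
  have h2 := hw.append (h.wk hij).reverse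
  have : ∀ x y : ZMod 2, x ≠ y → x + y = 1 := by decide
  rw [this _ _ hp] at h2
  exact h.min _ _ h2

theorem injOn (h : T.IsShortest w k a) {i j : ℕ} (hij : i < j) (hjk : j < i + k) :
    a i ≠ a j := by
  intro heq
  have h0 : T.Wk w 0 (a i) (a j) 0 := by rw [← heq]; exact Wk.nil _
  by_cases hp : 0 = ∑ t ∈ Finset.Ico i j, w {a t, a (t + 1)}
  · have := h.le_of_eq hij.le hjk.le (hp ▸ h0)
    omega
  · have := h.le_of_ne hij.le h0 hp
    omega

theorem three_le (h : T.IsShortest w k a) : 3 ≤ k := by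
  by_contra hk
  have hodd := h.odd
  have hper := h.per 0
  have : k = 0 ∨ k = 1 ∨ k = 2 := by omega
  rcases this with rfl | rfl | rfl
  · simp at hodd
  · exact ne_of_pair_mem_edges (h.edge 0) hper.symm
  · rw [Finset.sum_range_succ, Finset.sum_range_one] at hodd
    rw [zero_add] at hper
    rw [show 1 + 1 = 2 from rfl, hper, Finset.pair_comm (a 1), zero_add, zmod_add_self] at hodd
    exact zero_ne_one hodd

theorem exists_list (h : T.IsShortest w k a) :
    ∃ c, T.IsCycle c ∧ c.length = k ∧ cyc c = a := by
  have h3 := h.three_le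
  set c := (List.range k).map a with hc
  have hl : c.length = k := by simp [hc]
  have hmod : ∀ i, a (i % k) = a i := by
    intro i
    induction i using Nat.strong_induction_on with
    | _ i ih =>
      rcases Nat.lt_or_ge i k with hi | hi
      · rw [Nat.mod_eq_of_lt hi]
      · rw [Nat.mod_eq_sub_mod hi, ih _ (by omega), ← h.per (i - k)]
        congr 1; omega
  have hcyc : cyc c = a := by
    ext i
    have hi := Nat.mod_lt i (show 0 < k by omega)
    unfold cyc
    rw [hl, List.getD_eq_getElem _ _ (by omega)]
    simp [hc, hmod]
  refine ⟨c, ⟨by omega, ?_, ?_⟩, hl, hcyc⟩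
  · refine List.Nodup.map_on ?_ List.nodup_range
    intro i hi j hj hij
    rw [List.mem_range] at hi hj
    rcases Nat.lt_trichotomy i j with h' | h' | h'
    · exact absurd hij (h.injOn h' (by omega))
    · exact h'
    · exact absurd hij.symm (h.injOn h' (by omega))
  · intro e he
    obtain ⟨i, rfl⟩ := (mem_cycEdges (by omega)).1 he
    rw [hcyc]
    exact h.edge i

end IsShortest

theorem sum_eq_pr_cob (v : ℕ) (Z : Finset ℕ → ZMod 2) :
    ∑ e ∈ T.edges with v ∈ e, Z e = T.pr (cob fun u => if u = v then 1 else 0) Z := by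
  rw [pr, Finset.sum_filter]
  refine Finset.sum_congr rfl fun e _ => ?_
  simp [cob]

theorem exists_index {c : List ℕ} (s : ℕ) {v : ℕ} (hv : v ∈ c) :
    ∃ t, s ≤ t ∧ t < s + c.length ∧ v = cyc c t := by
  induction s with
  | zero =>
    obtain ⟨i, hi, rfl⟩ := exists_cyc hv
    exact ⟨i, by omega, by omega, rfl⟩
  | succ s ih =>
    obtain ⟨t, h1, h2, rfl⟩ := ih
    rcases Nat.eq_or_lt_of_le h1 with rfl | h1
    · exact ⟨s + c.length, by omega, by omega, by unfold cyc; rw [Nat.add_mod_right]⟩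
    · exact ⟨t, h1, by omega, rfl⟩

/-- A shortest odd closed path `c`, its Poincaré dual `α` (with local data `lam`), and a
representative `w` of the orientation class, both normalised so as to be concentrated, among the
edges of `c`, on the edge number `s - 1`. -/
structure IsCut (T : Triangulation) (c : List ℕ) (s : ℕ) (w : Finset ℕ → ZMod 2)
    (lam : ℕ → Finset ℕ → ZMod 2) (α : Finset ℕ → ZMod 2) : Prop where
  cycle : T.IsCycle c
  cls : T.IsOrClass w
  sh : T.IsShortest w c.length (cyc c)
  w_zero : ∀ t, s ≤ t → t + 1 < s + c.length → w {cyc c t, cyc c (t + 1)} = 0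
  w_one : ∀ t, t + 1 = s + c.length → w {cyc c t, cyc c (t + 1)} = 1
  dual : T.Dual lam (fun e => if e ∈ cycEdges c then 1 else 0) α
  lam_zero : ∀ v ∉ c, ∀ f ∈ T.faces, v ∈ f → lam v f = 0
  α_zero : ∀ t, s ≤ t → t + 1 < s + c.length → α {cyc c t, cyc c (t + 1)} = 0
  α_one : ∀ t, t + 1 = s + c.length → α {cyc c t, cyc c (t + 1)} = 1
  pr_one : T.pr α (fun e => if e ∈ cycEdges c then 1 else 0) = 1

theorem pr_indicator {c : List ℕ} (hc : T.IsCycle c) (ζ : Finset ℕ → ZMod 2) :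
    T.pr ζ (fun e => if e ∈ cycEdges c then 1 else 0) =
      ∑ t ∈ Finset.range c.length, ζ {cyc c t, cyc c (t + 1)} := by
  have h1 : T.pr ζ (fun e => if e ∈ cycEdges c then 1 else 0) = ∑ e ∈ cycEdges c, ζ e := by
    simp only [pr, mul_ite, mul_one, mul_zero]
    rw [← Finset.sum_filter, Finset.filter_mem_eq_inter, Finset.inter_eq_right.2 hc.2.2]
  have hinj := card_cycEdges hc
  rw [h1]
  unfold cycEdges at hinj ⊢
  rw [Finset.sum_image]
  · refine Finset.sum_congr rfl fun t ht => ?_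
    unfold cyc
    rw [Nat.mod_eq_of_lt (Finset.mem_range.1 ht)]
  · apply Finset.card_image_iff.1
    rw [hinj, Finset.card_range]

/-- A potential making a function vanish along a path, with prescribed values elsewhere. -/
theorem exists_potential {c : List ℕ} (hc : T.IsCycle c) (ζ : Finset ℕ → ZMod 2)
    (V : ℕ → ZMod 2) : ∃ U : ℕ → ZMod 2, (∀ v ∉ c, U v = V v) ∧
      ∀ t, t + 1 < c.length → (ζ + cob U) {cyc c t, cyc c (t + 1)} = 0 := by
  obtain ⟨h3, hnd, hE⟩ := hc
  have h0 : 0 < c.length := by omega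
  have hinj : ∀ i < c.length, ∀ j < c.length, cyc c i = cyc c j → i = j := by
    intro i hi j hj h
    rwa [cyc_inj hnd h0, Nat.mod_eq_of_lt hi, Nat.mod_eq_of_lt hj] at h
  set U : ℕ → ZMod 2 := fun v => if h : ∃ t < c.length, v = cyc c t then
    ∑ s ∈ Finset.range h.choose, ζ {cyc c s, cyc c (s + 1)} else V v with hU
  have hval : ∀ t < c.length, U (cyc c t) =
      ∑ s ∈ Finset.range t, ζ {cyc c s, cyc c (s + 1)} := by
    intro t ht
    have h : ∃ s < c.length, cyc c t = cyc c s := ⟨t, ht, rfl⟩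
    simp only [hU, dif_pos h]
    rw [← hinj t ht _ h.choose_spec.1 h.choose_spec.2]
  refine ⟨U, ?_, ?_⟩
  · intro v hv
    apply dif_neg
    rintro ⟨t, -, rfl⟩
    exact hv (cyc_mem h0 t)
  · intro t ht
    rw [Pi.add_apply, cob_pair U (ne_of_pair_mem_edges (hE _ ((mem_cycEdges h0).2 ⟨t, rfl⟩))),
      hval t (by omega), hval (t + 1) ht, Finset.sum_range_succ]
    grind

theorem IsOrClass.exists_isCut {w : Finset ℕ → ZMod 2} (h : T.IsOrClass w) :
    ∃ c w lam α, T.IsCut c 0 w lam α := by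
  obtain ⟨k, a, ha⟩ := h.exists_isShortest
  obtain ⟨c, hc, rfl, rfl⟩ := ha.exists_list
  have h0 : 0 < c.length := by have := hc.1; omega
  obtain ⟨lam, α, hd⟩ := (isCyc_indicator hc).exists_dual
  have hprα := h.pr_self _ _ _ hd
  rw [pr_indicator hc w, ha.odd] at hprα
  obtain ⟨U, -, hU⟩ := exists_potential hc w 0
  choose! φ hφ using fun v => (mem_verts (T := T) (v := v)).1
  obtain ⟨V, hV', hV⟩ := exists_potential hc α fun v => lam v (φ v)
  have hone : ∀ ζ : Finset ℕ → ZMod 2,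
      ∑ t ∈ Finset.range c.length, ζ {cyc c t, cyc c (t + 1)} = 1 →
      (∀ t, t + 1 < c.length → ζ {cyc c t, cyc c (t + 1)} = 0) →
      ∀ t, t + 1 = 0 + c.length → ζ {cyc c t, cyc c (t + 1)} = 1 := by
    intro ζ h1 h2 t ht
    rw [show c.length = t + 1 by omega, Finset.sum_range_succ, Finset.sum_eq_zero, zero_add] at h1
    · exact h1
    · intro s hs
      rw [Finset.mem_range] at hs
      exact h2 s (by omega)
  have hpr_right : T.pr (α + cob V) (fun e => if e ∈ cycEdges c then 1 else 0) = 1 := by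
    rw [pr_add_left, (isCyc_indicator hc).pr_cob, add_zero, ← hprα]
  refine ⟨c, w + cob U, fun v f => lam v f + V v, α + cob V, hc, h.add_cob U, ha.add_cob U,
    fun t _ ht => hU t (by omega), hone _ (ha.add_cob U).odd hU, hd.add_cob V, ?_,
    fun t _ ht => hV t (by omega), hone _ ?_ hV, hpr_right⟩
  · intro v hv f hf hvf
    have hvV : v ∈ T.verts := mem_verts.2 ⟨f, hf, hvf⟩
    rw [hV' v hv]
    have : lam v f = lam v (φ v) := by
      refine eq_on_star (T := T) (φ := lam v) ?_ hf (hφ v hvV).1 hvf (hφ v hvV).2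
      intro u huv f hf g hg hfg huf hug
      have := hd.vert v u huv.symm f hf g hg hfg huf hug
      rw [if_neg fun h => hv (mem_of_mem_cycEdges h0 h (by simp))] at this
      grind
    rw [this, zmod_add_self]
  · rw [← pr_indicator hc, hpr_right]

/-- The indicator of one edge. -/
def ech (d e : Finset ℕ) : ZMod 2 := if e = d then 1 else 0

theorem pr_ech {d : Finset ℕ} (hd : d ∈ T.edges) (ζ : Finset ℕ → ZMod 2) :
    T.pr ζ (ech d) = ζ d := by
  simp [pr, ech, hd]

/-- The closed path from `x` to the vertex `i` of `c`, along `c` up to the vertex `j`, and back. -/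
noncomputable def loop (c : List ℕ) (x i j : ℕ) : Finset ℕ → ZMod 2 :=
  ech {cyc c i, x} + ech {cyc c j, x} + ∑ t ∈ Finset.Ico i j, ech {cyc c t, cyc c (t + 1)}

theorem pr_loop {c : List ℕ} (hc : T.IsCycle c) {x i j : ℕ} (hi : {cyc c i, x} ∈ T.edges)
    (hj : {cyc c j, x} ∈ T.edges) (ζ : Finset ℕ → ZMod 2) : T.pr ζ (loop c x i j) =
      ζ {cyc c i, x} + ζ {cyc c j, x} + ∑ t ∈ Finset.Ico i j, ζ {cyc c t, cyc c (t + 1)} := by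
  have h0 : 0 < c.length := by have := hc.1; omega
  rw [loop, pr_add_right, pr_add_right, pr_ech hi, pr_ech hj]
  congr 1
  simp only [pr, Finset.sum_apply, Finset.mul_sum]
  rw [Finset.sum_comm]
  exact Finset.sum_congr rfl fun t _ => pr_ech (hc.2.2 _ ((mem_cycEdges h0).2 ⟨t, rfl⟩)) ζ

theorem sum_Ico_potential {m : ℕ → ZMod 2} {i j : ℕ} (hij : i ≤ j) :
    ∑ t ∈ Finset.Ico i j, (m t + m (t + 1)) = m i + m j := by
  induction j, hij using Nat.le_induction with
  | base => simp [zmod_add_self]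
  | succ j hij ih => rw [Finset.sum_Ico_succ_top hij, ih]; grind

theorem isCyc_loop {c : List ℕ} (hc : T.IsCycle c) {x i j : ℕ} (hij : i ≤ j)
    (hi : {cyc c i, x} ∈ T.edges) (hj : {cyc c j, x} ∈ T.edges) : T.IsCyc (loop c x i j) := by
  intro v
  have h0 : 0 < c.length := by have := hc.1; omega
  rw [sum_eq_pr_cob, pr_loop hc hi hj]
  simp only [cob_pair _ (ne_of_pair_mem_edges hi), cob_pair _ (ne_of_pair_mem_edges hj),
    cob_pair _ (ne_of_pair_mem_edges (hc.2.2 _ ((mem_cycEdges h0).2 ⟨_, rfl⟩)))]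
  rw [sum_Ico_potential (m := fun t => if cyc c t = v then 1 else 0) hij]
  grind

theorem loop_eq_zero {c : List ℕ} (h0 : 0 < c.length) {x i j : ℕ} {e : Finset ℕ}
    (hi : e ≠ {cyc c i, x}) (hj : e ≠ {cyc c j, x}) (he : e ∉ cycEdges c) : loop c x i j e = 0 := by
  simp only [loop, Pi.add_apply, Finset.sum_apply, ech]
  rw [Finset.sum_eq_zero fun t _ => if_neg fun h => he ((mem_cycEdges h0).2 ⟨t, h⟩)]
  simp [hi, hj]

theorem eq_on_star_of_cycle {c : List ℕ} (hc : T.IsCycle c) {v : ℕ} (hv : v ∈ c)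
    {lam ν : Finset ℕ → ZMod 2}
    (hlam : ∀ e ∈ T.edges, v ∈ e → ∀ f ∈ T.faces, ∀ g ∈ T.faces, f ≠ g → e ⊆ f → e ⊆ g →
      lam f + lam g = if e ∈ cycEdges c then 1 else 0)
    (hν : ∀ e ∈ T.edges, v ∈ e → e ∉ cycEdges c → ∀ f ∈ T.faces, ∀ g ∈ T.faces, f ≠ g → e ⊆ f →
      e ⊆ g → ν f = ν g) :
    ∃ J K, ∀ f ∈ T.faces, v ∈ f → ν f = J * lam f + K := by
  have h0 : 0 < c.length := by have := hc.1; omega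
  obtain ⟨i, -, hi⟩ := exists_cyc hv
  have hvi : v = cyc c (i + c.length - 1 + 1) := by
    rw [hi, cyc_inj hc.2.1 h0, show i + c.length - 1 + 1 = i + c.length by omega, Nat.add_mod_right]
  set t := i + c.length - 1
  set x : Finset ℕ → ZMod 2 := fun f => if v ∈ f then ν f else 0 with hx
  have hbd : ∀ e, v ∈ e → e.card = 2 → ∀ f ∈ T.faces, ∀ g ∈ T.faces, f ≠ g → e ⊆ f → e ⊆ g →
      T.bd x e = ν f + ν g := by
    intro e hve he f hf g hg hfg hef heg
    rw [bd_pair he hf hg hfg hef heg, hx]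
    simp only [if_pos (hef hve), if_pos (heg hve)]
  set Y : Finset ℕ → ZMod 2 := fun e => if v ∈ e then T.bd x e else 0 with hY
  have hY0 : ∀ e ∈ T.edges, e ∉ cycEdges c → Y e = 0 := by
    intro e he hec
    by_cases hve : v ∈ e
    · obtain ⟨f, g, hf, hg, hfg, hef, heg⟩ := exists_faces_of_edge he
      simp only [hY, if_pos hve]
      rw [hbd e hve (mem_edges.1 he).1 f hf g hg hfg hef heg,
        hν e he hve hec f hf g hg hfg hef heg, zmod_add_self]
    · exact if_neg hve
  have hsum := sum_at_cyc hc hY0 t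
  rw [← hvi] at hsum
  have hz : ∑ e ∈ T.edges with v ∈ e, Y e = 0 := by
    rw [← isCyc_bd x v]
    exact Finset.sum_congr rfl fun e he => if_pos (Finset.mem_filter.1 he).2
  rw [hz] at hsum
  have hJ : ∀ e ∈ cycEdges c, v ∈ e → Y e = Y {cyc c t, v} := by
    intro e he hve
    obtain ⟨j, rfl⟩ := (mem_cycEdges h0).1 he
    rw [hvi] at hve
    simp only [Finset.mem_insert, Finset.mem_singleton, cyc_inj hc.2.1 h0] at hve
    rcases hve with h | h
    · rw [← edge_congr h, ← hvi]
      grind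
    · rw [← edge_congr (mod_add_cases h), ← hvi]
  by_cases hst : ∃ f ∈ T.faces, v ∈ f
  · obtain ⟨f₀, hf₀, hv₀⟩ := hst
    refine ⟨Y {cyc c t, v}, ν f₀ + Y {cyc c t, v} * lam f₀, fun f hf hvf => ?_⟩
    have : ν f + Y {cyc c t, v} * lam f = ν f₀ + Y {cyc c t, v} * lam f₀ := by
      refine eq_on_star (T := T) (φ := fun f => ν f + Y {cyc c t, v} * lam f) ?_ hf hf₀ hvf hv₀
      intro u huv f hf g hg hfg hef heg
      have hve : v ∈ ({v, u} : Finset ℕ) := by simp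
      have he : ({v, u} : Finset ℕ) ∈ T.edges :=
        mem_edges.2 ⟨Finset.card_pair huv.symm, f, hf, hef⟩
      have h1 := hlam _ he hve f hf g hg hfg hef heg
      by_cases hec : ({v, u} : Finset ℕ) ∈ cycEdges c
      · rw [if_pos hec] at h1
        have h2 := hJ _ hec hve
        have h3 := hbd _ hve (mem_edges.1 he).1 f hf g hg hfg hef heg
        have h4 : Y {v, u} = T.bd x {v, u} := if_pos hve
        grind
      · rw [if_neg hec] at h1
        have h2 := hν _ he hve hec f hf g hg hfg hef heg
        grind
    grind
  · exact ⟨0, 0, fun f hf hvf => absurd ⟨f, hf, hvf⟩ hst⟩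

/-- A vertex `x` off `c` joined to the vertices `i` and `j` of `c` by edges lying on the same side
of `c`, which close up to an odd path. -/
structure IsBad (T : Triangulation) (c : List ℕ) (s : ℕ) (w α : Finset ℕ → ZMod 2) (σ : ZMod 2)
    (x i j : ℕ) : Prop where
  not_mem : x ∉ c
  le : s ≤ i
  lt : i < j
  lt_add : j < s + c.length
  left : {cyc c i, x} ∈ T.edges
  right : {cyc c j, x} ∈ T.edges
  α_left : α {cyc c i, x} = σ
  α_right : α {cyc c j, x} = σ
  ne : w {cyc c i, x} ≠ w {cyc c j, x}

namespace IsCut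

variable {c : List ℕ} {s : ℕ} {w α : Finset ℕ → ZMod 2} {lam : ℕ → Finset ℕ → ZMod 2}

theorem length_pos (h : T.IsCut c s w lam α) : 0 < c.length := by
  have := h.cycle.1
  omega

theorem mem_edges (h : T.IsCut c s w lam α) (t : ℕ) : {cyc c t, cyc c (t + 1)} ∈ T.edges :=
  h.sh.edge t

theorem mem_cycEdges (h : T.IsCut c s w lam α) (t : ℕ) :
    {cyc c t, cyc c (t + 1)} ∈ cycEdges c :=
  (Triangulation.mem_cycEdges h.length_pos).2 ⟨t, rfl⟩

theorem cyc_ne (h : T.IsCut c s w lam α) {i j : ℕ} (hij : i < j) (hj : j < i + c.length) :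
    cyc c i ≠ cyc c j :=
  h.sh.injOn hij hj

theorem α_off (h : T.IsCut c s w lam α) {u v : ℕ} (he : {u, v} ∈ T.edges) (hu : u ∉ c)
    (hv : v ∉ c) : α {u, v} = 0 := by
  obtain ⟨-, f, hf, hef⟩ := Triangulation.mem_edges.1 he
  rw [pair_subset] at hef
  rw [h.dual.face f hf u hef.1 v hef.2 (ne_of_pair_mem_edges he), h.lam_zero u hu f hf hef.1,
    h.lam_zero v hv f hf hef.2, add_zero]

theorem α_eq_lam (h : T.IsCut c s w lam α) {u v : ℕ} (hv : v ∉ c) {f : Finset ℕ}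
    (hf : f ∈ T.faces) (hef : {u, v} ⊆ f) (huv : u ≠ v) : α {u, v} = lam u f := by
  rw [pair_subset] at hef
  rw [h.dual.face f hf u hef.1 v hef.2 huv, h.lam_zero v hv f hf hef.2, add_zero]

theorem sum_Ico_eq_zero (h : T.IsCut c s w lam α) {i j : ℕ} (hi : s ≤ i)
    (hj : j < s + c.length) : ∑ t ∈ Finset.Ico i j, w {cyc c t, cyc c (t + 1)} = 0 := by
  refine Finset.sum_eq_zero fun t ht => ?_
  rw [Finset.mem_Ico] at ht
  exact h.w_zero t (by omega) (by omega)

theorem chord_mem (h : T.IsCut c s w lam α) {u v : ℕ} (hu : u ∈ c) (hv : v ∈ c)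
    (he : {u, v} ∈ T.edges) : {u, v} ∈ cycEdges c := by
  obtain ⟨i, hi, hi', rfl⟩ := exists_index s hu
  obtain ⟨j, hj, hj', rfl⟩ := exists_index s hv
  wlog hij : i ≤ j generalizing i j
  · rw [Finset.pair_comm]
    exact this j hj hj' hv i hi hi' hu (by rwa [Finset.pair_comm]) (by omega)
  have hne : i ≠ j := by rintro rfl; exact ne_of_pair_mem_edges he rfl
  have hsum := h.sum_Ico_eq_zero hi hj'
  have hw := Wk.single (w := w) he
  have hd : j = i + 1 ∨ j + 1 = i + c.length := by
    by_cases h0 : w {cyc c i, cyc c j} = 0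
    · rw [h0, ← hsum] at hw
      have := h.sh.le_of_eq hij (by omega) hw
      omega
    · have := h.sh.le_of_ne hij hw (by rwa [hsum])
      omega
  rcases hd with rfl | hd
  · exact h.mem_cycEdges i
  · rw [← h.sh.per i, ← hd, Finset.pair_comm]
    exact h.mem_cycEdges j

theorem length_le (h : T.IsCut c s w lam α) {σ : ZMod 2} {x i j : ℕ}
    (hb : T.IsBad c s w α σ x i j) : c.length ≤ j - i + 2 := by
  have h1 := (Wk.single (w := w) hb.left).append (Wk.single (w := w) hb.right).reverse
  have := h.sh.le_of_ne hb.lt.le h1 (by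
    rw [h.sum_Ico_eq_zero hb.le hb.lt_add]
    have : ∀ a b : ZMod 2, a ≠ b → a + b ≠ 0 := by decide
    exact this _ _ hb.ne)
  omega

theorem α_eq_w (h : T.IsCut c s w lam α) {e : Finset ℕ} (he : e ∈ cycEdges c) : α e = w e := by
  obtain ⟨i, rfl⟩ := (Triangulation.mem_cycEdges h.length_pos).1 he
  obtain ⟨t, hs, ht, hi⟩ := exists_index s (cyc_mem h.length_pos i)
  rw [edge_congr ((cyc_inj h.cycle.2.1 h.length_pos).1 hi)]
  rcases Nat.lt_or_ge (t + 1) (s + c.length) with h1 | h1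
  · rw [h.α_zero t hs h1, h.w_zero t hs h1]
  · rw [h.α_one t (by omega), h.w_one t (by omega)]

/-- Exchanging the two sides of the cycle. -/
theorem flip (h : T.IsCut c s w lam α) :
    T.IsCut c s w (fun v f => lam v f + if v ∈ c then 1 else 0)
      (α + cob fun v => if v ∈ c then 1 else 0) := by
  have hα : ∀ t, (α + cob fun v => if v ∈ c then 1 else 0) {cyc c t, cyc c (t + 1)} =
      α {cyc c t, cyc c (t + 1)} := by
    intro t
    rw [Pi.add_apply, cob_pair _ (ne_of_pair_mem_edges (h.mem_edges t)),
      if_pos (cyc_mem h.length_pos _), if_pos (cyc_mem h.length_pos _), zmod_add_self, add_zero]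
  refine ⟨h.cycle, h.cls, h.sh, h.w_zero, h.w_one, h.dual.add_cob _, ?_, ?_, ?_, ?_⟩
  · intro v hv f hf hvf
    rw [h.lam_zero v hv f hf hvf, if_neg hv, add_zero]
  · exact fun t h1 h2 => (hα t).trans (h.α_zero t h1 h2)
  · exact fun t h1 => (hα t).trans (h.α_one t h1)
  · rw [pr_add_left, h.pr_one, (isCyc_indicator h.cycle).pr_cob, add_zero]

theorem isBad_of_flip (h : T.IsCut c s w lam α) {σ : ZMod 2} {x i j : ℕ}
    (hb : T.IsBad c s w (α + cob fun v => if v ∈ c then 1 else 0) σ x i j) :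
    T.IsBad c s w α (σ + 1) x i j := by
  have key : ∀ t, {cyc c t, x} ∈ T.edges →
      (α + cob fun v => if v ∈ c then 1 else 0) {cyc c t, x} = σ → α {cyc c t, x} = σ + 1 := by
    intro t he hσ
    rw [Pi.add_apply, cob_pair _ (ne_of_pair_mem_edges he), if_pos (cyc_mem h.length_pos _),
      if_neg hb.not_mem] at hσ
    grind
  exact ⟨hb.not_mem, hb.le, hb.lt, hb.lt_add, hb.left, hb.right, key _ hb.left hb.α_left,
    key _ hb.right hb.α_right, hb.ne⟩

/-- Moving the concentrated edge one step along the cycle. -/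
theorem shift (h : T.IsCut c s w lam α) :
    T.IsCut c (s + 1) (w + cob fun v => if v = cyc c s then 1 else 0)
      (fun v f => lam v f + if v = cyc c s then 1 else 0)
      (α + cob fun v => if v = cyc c s then 1 else 0) := by
  have h3 := h.cycle.1
  have key : ∀ ζ : Finset ℕ → ZMod 2,
      (∀ t, s ≤ t → t + 1 < s + c.length → ζ {cyc c t, cyc c (t + 1)} = 0) →
      (∀ t, t + 1 = s + c.length → ζ {cyc c t, cyc c (t + 1)} = 1) →
      (∀ t, s + 1 ≤ t → t + 1 < s + 1 + c.length →
        (ζ + cob fun v => if v = cyc c s then 1 else 0) {cyc c t, cyc c (t + 1)} = 0) ∧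
      (∀ t, t + 1 = s + 1 + c.length →
        (ζ + cob fun v => if v = cyc c s then 1 else 0) {cyc c t, cyc c (t + 1)} = 1) := by
    intro ζ h0 h1
    refine ⟨fun t ht ht' => ?_, fun t ht => ?_⟩
    · rw [Pi.add_apply, cob_pair _ (ne_of_pair_mem_edges (h.mem_edges t)),
        if_neg (h.cyc_ne (by omega) (by omega)).symm]
      rcases Nat.lt_or_ge (t + 1) (s + c.length) with h2 | h2
      · rw [h0 t (by omega) h2, if_neg (h.cyc_ne (by omega) (by omega)).symm, add_zero, add_zero]
      · have h4 : t + 1 = s + c.length := by omega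
        rw [h1 t h4, h4, h.sh.per, if_pos rfl, zero_add]
        rfl
    · obtain rfl : t = s + c.length := by omega
      rw [Pi.add_apply, cob_pair _ (ne_of_pair_mem_edges (h.mem_edges _)), add_right_comm,
        h.sh.per, h.sh.per, if_pos rfl, if_neg (h.cyc_ne (by omega) (by omega)).symm,
        h0 s le_rfl (by omega), zero_add, add_zero]
  obtain ⟨hw0, hw1⟩ := key w h.w_zero h.w_one
  obtain ⟨hα0, hα1⟩ := key α h.α_zero h.α_one
  refine ⟨h.cycle, h.cls.add_cob _, h.sh.add_cob _, hw0, hw1, h.dual.add_cob _, ?_, hα0, hα1, ?_⟩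
  · intro v hv f hf hvf
    rw [h.lam_zero v hv f hf hvf, if_neg, add_zero]
    rintro rfl
    exact hv (cyc_mem h.length_pos _)
  · rw [pr_add_left, h.pr_one, (isCyc_indicator h.cycle).pr_cob, add_zero]

theorem pr_w_eq_zero (h : T.IsCut c s w lam α) {Z : Finset ℕ → ZMod 2} (hZ : T.IsCyc Z)
    (hα : T.pr α Z = 0) (hw : T.pr w Z = 0) {ζ : Finset ℕ → ZMod 2} (hζ : T.IsCocyc ζ) :
    T.pr ζ Z = 0 :=
  h.cls.killed _ _ _ h.dual h.pr_one Z hZ hα hw ζ hζ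

/-- If the edges leaving `c` on one side do so coherently, the surface has an NSC. -/
theorem exists_isNSC (h : T.IsCut c s w lam α)
    (hg : ∀ x ∉ c, ∀ u ∈ c, ∀ v ∈ c, {u, x} ∈ T.edges → {v, x} ∈ T.edges → α {u, x} = 1 →
      α {v, x} = 1 → w {u, x} = w {v, x}) : ∃ c', T.IsNSC c' := by
  have hz : ∀ z : ZMod 2, z = 0 ∨ z = 1 := by decide
  set U : ℕ → ZMod 2 := fun x => if x ∉ c ∧ ∃ u ∈ c, {u, x} ∈ T.edges ∧ α {u, x} = 1 ∧
    w {u, x} = 0 then 1 else 0 with hU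
  have hUc : ∀ v ∈ c, U v = 0 := fun v hv => if_neg fun h => h.1 hv
  have hmix : ∀ u v, u ∈ c → v ∉ c → {u, v} ∈ T.edges → α {u, v} = 1 →
      (w + cob U + α) {u, v} = 0 := by
    intro u v hu hv he h1
    rw [Pi.add_apply, Pi.add_apply, cob_pair U (ne_of_pair_mem_edges he), hUc u hu, h1]
    rcases hz (w {u, v}) with h0 | h0
    · rw [h0, show U v = 1 from if_pos ⟨hv, u, hu, he, h1, h0⟩]
      rfl
    · rw [h0, show U v = 0 from if_neg ?_]
      · rfl
      · rintro ⟨-, u', hu', he', h1', h0'⟩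
        rw [hg v hv u hu u' hu' he he' h1 h1', h0'] at h0
        exact zero_ne_one h0
  have hkey : ∀ u v, {u, v} ∈ T.edges → α {u, v} = 1 → (w + cob U + α) {u, v} = 0 := by
    intro u v he h1
    by_cases hu : u ∈ c <;> by_cases hv : v ∈ c
    · rw [Pi.add_apply, Pi.add_apply, cob_pair U (ne_of_pair_mem_edges he), hUc u hu, hUc v hv,
        h.α_eq_w (h.chord_mem hu hv he), add_zero, add_zero, zmod_add_self]
    · exact hmix u v hu hv he h1
    · rw [Finset.pair_comm] at he h1 ⊢
      exact hmix v u hv hu he h1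
    · rw [h.α_off he hu hv] at h1
      exact absurd h1 zero_ne_one
  have hα := h.dual.isCocyc
  have hζ : T.IsCocyc (w + cob U + α) := (h.cls.cocyc.add (isCocyc_cob U)).add hα
  have hprζ : ∀ Z, T.IsCyc Z → T.pr (w + cob U + α) Z = T.pr w Z + T.pr α Z := by
    intro Z hZ
    rw [pr_add_left, pr_add_left, hZ.pr_cob, add_zero]
  refine exists_isNSC_of_separated
    (X := fun f => if ∃ e ∈ T.edges, e ⊆ f ∧ α e ≠ 0 then 1 else 0) hα hζ
    ⟨_, isCyc_indicator h.cycle, by rw [h.pr_one]; exact one_ne_zero⟩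
    ⟨_, isCyc_orCyc, ?_⟩ ?_ ?_ ?_
  · rw [hprζ _ isCyc_orCyc, h.cls.pr_orCyc, h.cls.pr_orCyc_right _ _ _ h.dual, h.pr_one, zero_add]
    exact one_ne_zero
  · intro Z hZ h1 h2 ζ hζ
    rw [hprζ Z hZ, h1, add_zero] at h2
    exact h.pr_w_eq_zero hZ h1 h2 hζ
  · exact fun e he hne f hf hef => if_pos ⟨e, he, hef, hne⟩
  · intro e he hne f hf hef
    refine if_neg ?_
    rintro ⟨d, hd, hdf, hd0⟩
    obtain ⟨a, b, x, hab, hbx, rfl⟩ := exists_lt_lt hf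
    have hax := hab.trans hbx
    have h1 := hα.face_eq hab.ne hax.ne hbx.ne hf
    have h2 := hζ.face_eq hab.ne hax.ne hbx.ne hf
    have k1 := hkey a b (pair_mem_edges hf (by simp) (by simp) hab.ne)
    have k2 := hkey a x (pair_mem_edges hf (by simp) (by simp) hax.ne)
    have k3 := hkey b x (pair_mem_edges hf (by simp) (by simp) hbx.ne)
    have hmem : ∀ e ∈ T.edges, e ⊆ {a, b, x} → e = {a, b} ∨ e = {a, x} ∨ e = {b, x} := by
      intro e he hef
      have : e ∈ T.edges.filter fun e => e ⊆ {a, b, x} := Finset.mem_filter.2 ⟨he, hef⟩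
      rw [edges_of_face hab.ne hax.ne hbx.ne hf] at this
      simpa using this
    have hfin : ∀ a1 a2 a3 z1 z2 z3 : ZMod 2, a1 + (a2 + a3) = 0 → z1 + (z2 + z3) = 0 →
        (a1 = 1 → z1 = 0) → (a2 = 1 → z2 = 0) → (a3 = 1 → z3 = 0) →
        (a1 = 0 ∧ a2 = 0 ∧ a3 = 0) ∨ (z1 = 0 ∧ z2 = 0 ∧ z3 = 0) := by
      have hz : ∀ z : ZMod 2, z = 0 ∨ z = 1 := by decide
      intro a1 a2 a3 z1 z2 z3
      rcases hz a1 with rfl | rfl <;> rcases hz a2 with rfl | rfl <;>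
        rcases hz a3 with rfl | rfl <;> intro _ q k1 k2 k3 <;> simp_all
    rcases hfin _ _ _ _ _ _ h1 h2 k1 k2 k3 with ⟨q1, q2, q3⟩ | ⟨q1, q2, q3⟩
    · apply hd0
      rcases hmem d hd hdf with rfl | rfl | rfl <;> assumption
    · apply hne
      rcases hmem e he hef with rfl | rfl | rfl <;> assumption

theorem exists_isBad (h : T.IsCut c s w lam α) (hno : ¬ ∃ c', T.IsNSC c') :
    ∃ x i j, T.IsBad c s w α 1 x i j := by
  by_contra! hcon
  refine hno (h.exists_isNSC ?_)
  intro x hx u hu v hv hux hvx hαu hαv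
  obtain ⟨i, hi, hi', rfl⟩ := exists_index s hu
  obtain ⟨j, hj, hj', rfl⟩ := exists_index s hv
  by_contra hne
  rcases Nat.lt_trichotomy i j with hij | rfl | hij
  · exact hcon x i j ⟨hx, hi, hij, hj', hux, hvx, hαu, hαv, hne⟩
  · exact hne rfl
  · exact hcon x j i ⟨hx, hj, hij, hi', hvx, hux, hαv, hαu, Ne.symm hne⟩

theorem exists_isBad_side (h : T.IsCut c s w lam α) (hno : ¬ ∃ c', T.IsNSC c') (σ : ZMod 2) :
    ∃ x i j, T.IsBad c s w α σ x i j := by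
  have hz : ∀ z : ZMod 2, z = 1 + 1 ∨ z = 1 := by decide
  rcases hz σ with rfl | rfl
  · obtain ⟨x, i, j, hb⟩ := h.flip.exists_isBad hno
    exact ⟨x, i, j, h.isBad_of_flip hb⟩
  · exact h.exists_isBad hno

/-- The local data of a loop on one side of `c` is constant around each vertex of `c` on the other
side. -/
theorem exists_const (h : T.IsCut c s w lam α) {σ : ZMod 2} {x i j : ℕ}
    (hb : T.IsBad c s w α σ x i j) {μ : ℕ → Finset ℕ → ZMod 2} {η : Finset ℕ → ZMod 2}
    (hμ : T.Dual μ (loop c x i j) η) {v : ℕ} (hv : v ∈ c) :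
    ∃ m, ∀ f ∈ T.faces, v ∈ f → lam v f = σ + 1 → μ v f = m := by
  obtain ⟨J, K, hJK⟩ := eq_on_star_of_cycle (T := T) h.cycle hv (lam := lam v)
    (ν := fun f => μ v f * (lam v f + σ)) (by
      intro e he hve f hf g hg hfg hef heg
      obtain ⟨u, huv, rfl⟩ := exists_pair_mem he hve
      exact (h.dual.vert v u huv.symm f hf g hg hfg hef heg).symm) (by
      intro e he hve hec f hf g hg hfg hef heg
      obtain ⟨u, huv, rfl⟩ := exists_pair_mem he hve
      have h1 := h.dual.vert v u huv.symm f hf g hg hfg hef heg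
      rw [if_neg hec] at h1
      have h2 := hμ.vert v u huv.symm f hf g hg hfg hef heg
      have h3 : lam v f = lam v g := by grind
      by_cases hlam : lam v f = σ
      · simp only [← h3, hlam, zmod_add_self, mul_zero]
      have h4 : loop c x i j {v, u} = 0 := by
        have hne : ∀ t, α {cyc c t, x} = σ → ({v, u} : Finset ℕ) ≠ {cyc c t, x} := by
          intro t ht heq
          have hxu : x = u := by
            have : x ∈ ({v, u} : Finset ℕ) := by rw [heq]; simp
            simp only [Finset.mem_insert, Finset.mem_singleton] at this
            exact this.resolve_left fun h' => hb.not_mem (h' ▸ hv)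
          subst hxu
          rw [← heq, h.α_eq_lam hb.not_mem hf hef huv.symm] at ht
          exact hlam ht
        exact loop_eq_zero h.length_pos (hne i hb.α_left) (hne j hb.α_right) hec
      have h5 : μ v f = μ v g := by grind
      simp only [h3, h5])
  refine ⟨J * (σ + 1) + K, fun f hf hvf hl => ?_⟩
  have := hJK f hf hvf
  rw [hl] at this
  rw [← this]
  grind

theorem eq_of_isBad (h : T.IsCut c s w lam α) {σ : ZMod 2} {x i j x' i' j' : ℕ}
    (hb : T.IsBad c s w α σ x i j) (hb' : T.IsBad c s w α (σ + 1) x' i' j') : x = x' := by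
  by_contra hxx
  have hpr : ∀ {σ : ZMod 2} {x i j : ℕ}, T.IsBad c s w α σ x i j →
      T.pr α (loop c x i j) = 0 ∧ T.pr w (loop c x i j) = 1 := by
    intro σ x i j hb
    rw [pr_loop h.cycle hb.left hb.right, pr_loop h.cycle hb.left hb.right,
      h.sum_Ico_eq_zero hb.le hb.lt_add, hb.α_left, hb.α_right, Finset.sum_eq_zero]
    · have : ∀ a b : ZMod 2, a ≠ b → a + b + 0 = 1 := by decide
      exact ⟨by rw [zmod_add_self, add_zero], this _ _ hb.ne⟩
    · intro t ht
      rw [Finset.mem_Ico] at ht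
      have := hb.le
      have := hb.lt_add
      exact h.α_zero t (by omega) (by omega)
  have hcyc := isCyc_loop h.cycle hb.lt.le hb.left hb.right
  have hcyc' := isCyc_loop h.cycle hb'.lt.le hb'.left hb'.right
  obtain ⟨μ, η, hμ⟩ := hcyc.exists_dual
  have h1 : T.pr η (loop c x i j) = 1 := by
    rw [← h.cls.pr_self _ _ _ hμ, (hpr hb).2]
  have h2 := h.pr_w_eq_zero (hcyc.add hcyc')
    (by rw [pr_add_right, (hpr hb).1, (hpr hb').1, add_zero])
    (by rw [pr_add_right, (hpr hb).2, (hpr hb').2, zmod_add_self]) hμ.isCocyc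
  rw [pr_add_right, h1, pr_loop h.cycle hb'.left hb'.right] at h2
  choose! m hm using fun t => h.exists_const hb hμ (cyc_mem h.length_pos t)
  obtain ⟨M, hM⟩ : ∃ M, ∀ f ∈ T.faces, x' ∈ f → μ x' f = M := by
    obtain ⟨-, f₀, hf₀, he₀⟩ := Triangulation.mem_edges.1 hb'.left
    refine ⟨μ x' f₀, fun f hf hxf => ?_⟩
    refine eq_on_star (T := T) (φ := μ x') ?_ hf hf₀ hxf (he₀ (by simp))
    intro u hu f hf g hg hfg hef heg
    have h3 := hμ.vert x' u hu.symm f hf g hg hfg hef heg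
    have hmem : ∀ {y : ℕ}, ({x', u} : Finset ℕ) = {y, x} → y ∈ c → False := by
      intro y heq hy
      have : x' ∈ ({y, x} : Finset ℕ) := by rw [← heq]; simp
      simp only [Finset.mem_insert, Finset.mem_singleton] at this
      rcases this with rfl | rfl
      · exact hb'.not_mem hy
      · exact hxx rfl
    rw [loop_eq_zero h.length_pos (fun heq => hmem heq (cyc_mem h.length_pos _))
      (fun heq => hmem heq (cyc_mem h.length_pos _))
      (fun hc => hb'.not_mem (mem_of_mem_cycEdges h.length_pos hc (by simp)))] at h3
    grind
  have hend : ∀ t, {cyc c t, x'} ∈ T.edges → α {cyc c t, x'} = σ + 1 →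
      η {cyc c t, x'} = m t + M := by
    intro t he hα
    obtain ⟨-, f, hf, hef⟩ := Triangulation.mem_edges.1 he
    have hne := ne_of_pair_mem_edges he
    rw [h.α_eq_lam hb'.not_mem hf hef hne] at hα
    rw [pair_subset] at hef
    rw [hμ.face f hf _ hef.1 _ hef.2 hne, hM f hf hef.2, hm t f hf hef.1 hα]
  have hpath : ∀ t ∈ Finset.Ico i' j', η {cyc c t, cyc c (t + 1)} = m t + m (t + 1) := by
    intro t ht
    rw [Finset.mem_Ico] at ht
    have hl := hb'.le
    have hl' := hb'.lt_add
    have hα := h.α_zero t (by omega) (by omega)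
    have hE := h.mem_edges t
    have hne := ne_of_pair_mem_edges hE
    obtain ⟨f, hf, hef, hlam⟩ : ∃ f ∈ T.faces, {cyc c t, cyc c (t + 1)} ⊆ f ∧
        lam (cyc c t) f = σ + 1 := by
      obtain ⟨f, g, hf, hg, hfg, hef, heg⟩ := exists_faces_of_edge hE
      have h3 := h.dual.vert _ _ hne f hf g hg hfg hef heg
      rw [if_pos (h.mem_cycEdges t)] at h3
      have hz : ∀ a b r : ZMod 2, 1 = a + b → a = r ∨ b = r := by decide
      rcases hz _ _ (σ + 1) h3 with h4 | h4
      · exact ⟨f, hf, hef, h4⟩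
      · exact ⟨g, hg, heg, h4⟩
    rw [pair_subset] at hef
    have h3 := h.dual.face f hf _ hef.1 _ hef.2 hne
    rw [hα] at h3
    rw [hμ.face f hf _ hef.1 _ hef.2 hne, hm t f hf hef.1 hlam,
      hm (t + 1) f hf hef.2 (by grind)]
  rw [hend _ hb'.left hb'.α_left, hend _ hb'.right hb'.α_right, Finset.sum_congr rfl hpath,
    sum_Ico_potential hb'.lt.le] at h2
  have hz : ∀ a b d : ZMod 2, 1 + (a + d + (b + d) + (a + b)) ≠ 0 := by decide
  exact hz _ _ _ h2

theorem exists_isBad_pair (h : T.IsCut c s w lam α) (hno : ¬ ∃ c', T.IsNSC c') :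
    ∃ σ x, T.IsBad c s w α σ x s (s + c.length - 2) ∧
      T.IsBad c s w α (σ + 1) x (s + 1) (s + c.length - 1) := by
  obtain ⟨x, i, j, hb⟩ := h.exists_isBad_side hno 0
  obtain ⟨x', i', j', hb'⟩ := h.exists_isBad_side hno (0 + 1)
  obtain rfl := h.eq_of_isBad hb hb'
  have h01 : (0 : ZMod 2) ≠ 0 + 1 := by decide
  have n1 : i ≠ i' := by
    rintro rfl
    exact h01 (hb.α_left.symm.trans hb'.α_left)
  have n2 : i ≠ j' := by
    rintro rfl
    exact h01 (hb.α_left.symm.trans hb'.α_right)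
  have n3 : j ≠ i' := by
    rintro rfl
    exact h01 (hb.α_right.symm.trans hb'.α_left)
  have n4 : j ≠ j' := by
    rintro rfl
    exact h01 (hb.α_right.symm.trans hb'.α_right)
  have l1 := h.length_le hb
  have l2 := h.length_le hb'
  have := hb.le
  have := hb.lt
  have := hb.lt_add
  have := hb'.le
  have := hb'.lt
  have := hb'.lt_add
  rcases Nat.lt_or_ge i i' with hi | hi
  · obtain rfl : i = s := by omega
    obtain rfl : j = i + c.length - 2 := by omega
    obtain rfl : i' = i + 1 := by omega
    obtain rfl : j' = i + c.length - 1 := by omega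
    exact ⟨0, x, hb, hb'⟩
  · obtain rfl : i' = s := by omega
    obtain rfl : j' = i' + c.length - 2 := by omega
    obtain rfl : i = i' + 1 := by omega
    obtain rfl : j = i' + c.length - 1 := by omega
    exact ⟨0 + 1, x, hb', hb⟩

theorem exists_isNSC_of_isCut (h : T.IsCut c s w lam α) : ∃ c', T.IsNSC c' := by
  by_contra hno
  have h3 := h.cycle.1
  obtain ⟨σ, x, hb, hb'⟩ := h.exists_isBad_pair hno
  obtain ⟨ρ, y, hd, hd'⟩ := h.shift.exists_isBad_pair hno
  have hsame : ∀ (ζ : Finset ℕ → ZMod 2) (t : ℕ), s < t → t < s + c.length →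
      {cyc c t, y} ∈ T.edges →
      (ζ + cob fun v => if v = cyc c s then 1 else 0) {cyc c t, y} = ζ {cyc c t, y} := by
    intro ζ t ht ht' he
    rw [Pi.add_apply, cob_pair _ (ne_of_pair_mem_edges he), if_neg (h.cyc_ne ht ht').symm, if_neg,
      add_zero, add_zero]
    rintro rfl
    exact hd.not_mem (cyc_mem h.length_pos _)
  have hlt := hd.lt
  have hlt' := hd.lt_add
  have e1 : s + 1 + c.length - 2 = s + c.length - 1 := by omega
  rw [e1] at hd hlt
  have hbad : T.IsBad c s w α ρ y (s + 1) (s + c.length - 1) := by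
    refine ⟨hd.not_mem, by omega, hlt, by omega, hd.left, hd.right, ?_, ?_, ?_⟩
    · rw [← hsame α _ (by omega) (by omega) hd.left, hd.α_left]
    · rw [← hsame α _ (by omega) (by omega) hd.right, hd.α_right]
    · rw [← hsame w _ (by omega) (by omega) hd.left, ← hsame w _ (by omega) (by omega) hd.right]
      exact hd.ne
  have hyx : y = x := by
    have hz : ∀ a b : ZMod 2, b = a + 1 ∨ b + 1 = a + 1 := by decide
    rcases hz ρ σ with h4 | h4
    · exact h.eq_of_isBad hbad (h4 ▸ hb)
    · exact h.eq_of_isBad hbad (h4 ▸ hb')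
  subst hyx
  have k1 := hbad.α_left
  have k2 := hb'.α_left
  have k3 := hb.α_left
  have k4 := hd'.α_right
  rw [show s + 1 + c.length - 1 = s + c.length by omega, h.sh.per, Pi.add_apply,
    cob_pair _ (ne_of_pair_mem_edges hb.left), if_pos rfl, if_neg, k3] at k4
  · rw [k1] at k2
    rw [k2] at k4
    revert k4
    generalize σ = z
    revert z
    decide
  · rintro rfl
    exact hd.not_mem (cyc_mem h.length_pos _)

end IsCut

end Triangulation

/-- Every triangulation of the Klein bottle `N_2` contains a noncontractible separating cycle. -/
theorem every_triangulation_n2_has_NSC :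
    ∀ T : Triangulation, T.IsN 2 → ∃ c : List ℕ, T.IsNSC c := by
  intro T hT
  obtain ⟨w, hw⟩ := Triangulation.exists_isOrClass hT
  obtain ⟨c, w', lam, α, h⟩ := hw.exists_isCut
  exact h.exists_isNSC_of_isCut
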